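/- Let x ≺ y in L¹(0,∞). Then, working on (0,∞) ⊕ (0,∞) with x⊕0 and y⊕0, there exist sequences of pairwise disjoint measurable sets {Aₙ} and {Bₙ} of equal finite measure m(Aₙ) = m(Bₙ) < ∞, with ⋃ₙ Aₙ = ⋃ₙ Bₙ = (0,∞)⊕(0,∞), such that (x⊕0)·χ_{Bₙ} ≺ (y⊕0)·χ_{Aₙ} for every n. -/

import Mathlib

open MeasureTheory Set

/-- Decreasing rearrangement of `|f|` with respect to Lebesgue measure on `(0,∞)`. -/
noncomputable def rearr (f : ℝ → ℝ) (t : ℝ) : ℝ :=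
  sInf {s : ℝ | 0 ≤ s ∧ (volume.restrict (Set.Ioi (0:ℝ))) {x | s < |f x|} ≤ ENNReal.ofReal t}

/-- Positive part of a function. -/
noncomputable def posPart' (f : ℝ → ℝ) : ℝ → ℝ := fun t => max (f t) 0

/-- Negative part of a function. -/
noncomputable def negPart' (f : ℝ → ℝ) : ℝ → ℝ := fun t => max (-f t) 0

/-- Hardy–Littlewood–Pólya submajorization on `(0,∞)`. -/
def SubMaj (f g : ℝ → ℝ) : Prop :=
  ∀ t : ℝ, 0 ≤ t →
    (∫ s in Set.Ioc (0:ℝ) t, rearr f s) ≤ ∫ s in Set.Ioc (0:ℝ) t, rearr g s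

/-- Hardy–Littlewood–Pólya majorization on `(0,∞)`:
`f₊ ≺≺ g₊`, `f₋ ≺≺ g₋` and `∫ f = ∫ g`. -/
def Maj (f g : ℝ → ℝ) : Prop :=
  SubMaj (posPart' f) (posPart' g) ∧ SubMaj (negPart' f) (negPart' g) ∧
    (∫ t in Set.Ioi (0:ℝ), f t) = ∫ t in Set.Ioi (0:ℝ), g t

/-- Decreasing rearrangement of `|f|` with respect to a measure `ν`. -/
noncomputable def rearrM {α : Type*} [MeasurableSpace α] (ν : Measure α) (f : α → ℝ)
    (t : ℝ) : ℝ :=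
  sInf {s : ℝ | 0 ≤ s ∧ ν {p | s < |f p|} ≤ ENNReal.ofReal t}

/-- Hardy–Littlewood–Pólya majorization with respect to a measure `ν`. -/
def MajM {α : Type*} [MeasurableSpace α] (ν : Measure α) (f g : α → ℝ) : Prop :=
  (∀ t : ℝ, 0 ≤ t →
    (∫ s in Set.Ioc (0:ℝ) t, rearrM ν (fun p => max (f p) 0) s) ≤
      ∫ s in Set.Ioc (0:ℝ) t, rearrM ν (fun p => max (g p) 0) s) ∧
  (∀ t : ℝ, 0 ≤ t →
    (∫ s in Set.Ioc (0:ℝ) t, rearrM ν (fun p => max (-f p) 0) s) ≤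
      ∫ s in Set.Ioc (0:ℝ) t, rearrM ν (fun p => max (-g p) 0) s) ∧
  (∫ p, f p ∂ν) = ∫ p, g p ∂ν

/-- The measure on `(0,∞) ⊕ (0,∞)`, modelled as `ℝ × Fin 2` with the product of
Lebesgue measure restricted to `(0,∞)` and counting measure. -/
noncomputable def νSum : Measure (ℝ × Fin 2) :=
  (volume.restrict (Set.Ioi (0:ℝ))).prod (Measure.count : Measure (Fin 2))

/-- stop-loss transform -/
noncomputable def FF {α : Type*} [MeasurableSpace α] (ν : Measure α) (f : α → ℝ) (l : ℝ) : ℝ :=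
  ∫ p, max (f p - l) 0 ∂ν

section generic
variable {α : Type*} [MeasurableSpace α] {ν : Measure α} {f g : α → ℝ}

lemma FF_integrable (hf : Integrable f ν) {l : ℝ} (hl : 0 ≤ l) :
    Integrable (fun p => max (f p - l) 0) ν := by
  refine Integrable.mono hf ?_ (Filter.Eventually.of_forall fun p => ?_)
  · exact (hf.aestronglyMeasurable.sub aestronglyMeasurable_const).sup aestronglyMeasurable_const
  · rw [Real.norm_eq_abs, Real.norm_eq_abs, abs_of_nonneg (le_max_right _ _)]
    exact max_le (by linarith [le_abs_self (f p)]) (abs_nonneg _)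

lemma FF_nonneg (l : ℝ) : 0 ≤ FF ν f l := integral_nonneg fun _ => le_max_right _ _

lemma FF_zero (hf : ∀ p, 0 ≤ f p) : FF ν f 0 = ∫ p, f p ∂ν := by
  unfold FF; congr 1; ext p; simp [hf p]

lemma FF_congr (h : f =ᵐ[ν] g) (l : ℝ) : FF ν f l = FF ν g l := by
  unfold FF; apply integral_congr_ae; filter_upwards [h] with p hp; rw [hp]

lemma FF_chord (hf : Integrable f ν) {l1 l l2 c t : ℝ} (h0 : 0 ≤ l1) (h1 : l1 ≤ l) (h2 : l ≤ l2)
    (H1 : FF ν f l1 ≤ c - l1 * t) (H2 : FF ν f l2 ≤ c - l2 * t) : FF ν f l ≤ c - l * t := by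
  rcases eq_or_lt_of_le (h1.trans h2) with h | h
  · have : l = l1 := by linarith
    rw [this]; exact H1
  have key : (l2 - l1) * FF ν f l ≤ (l2 - l) * FF ν f l1 + (l - l1) * FF ν f l2 := by
    unfold FF
    rw [← integral_const_mul, ← integral_const_mul, ← integral_const_mul, ← integral_add]
    · apply integral_mono
      · exact (FF_integrable hf (by linarith)).const_mul _
      · exact ((FF_integrable hf (by linarith)).const_mul _).add
          ((FF_integrable hf (by linarith)).const_mul _)
      · intro p
        simp only
        have a1 := le_max_left (f p - l1) 0
        have a2 := le_max_right (f p - l1) 0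
        have b1 := le_max_left (f p - l2) 0
        have b2 := le_max_right (f p - l2) 0
        rcases max_cases (f p - l) 0 with ⟨e, _⟩ | ⟨e, _⟩ <;> rw [e] <;> nlinarith
    · exact (FF_integrable hf (by linarith)).const_mul _
    · exact (FF_integrable hf (by linarith)).const_mul _
  have : (l2 - l1) * FF ν f l ≤ (l2 - l1) * (c - l * t) := by nlinarith
  exact le_of_mul_le_mul_left this (by linarith)

lemma FF_ind (A : Set α) (hA : MeasurableSet A) {l : ℝ} (hl : 0 ≤ l) :
    FF ν (A.indicator f) l = ∫ p in A, max (f p - l) 0 ∂ν := by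
  unfold FF
  rw [← integral_indicator hA]
  congr 1; ext p
  by_cases h : p ∈ A <;> simp [h, hl]

lemma FF_split (hf : Integrable f ν) (A : Set α) (hA : MeasurableSet A) {l : ℝ} (hl : 0 ≤ l) :
    FF ν f l = FF ν (A.indicator f) l + FF ν (Aᶜ.indicator f) l := by
  rw [FF_ind A hA hl, FF_ind _ hA.compl hl]
  exact (integral_add_compl hA (FF_integrable hf hl)).symm

lemma FF_ind_mono (hf : Integrable f ν) {A A' : Set α} (hA : MeasurableSet A)
    (hA' : MeasurableSet A') (h : A ⊆ A') {l : ℝ} (hl : 0 ≤ l) :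
    FF ν (A.indicator f) l ≤ FF ν (A'.indicator f) l := by
  rw [FF_ind A hA hl, FF_ind _ hA' hl]
  exact setIntegral_mono_set (FF_integrable hf hl).integrableOn
    (Filter.Eventually.of_forall fun _ => le_max_right _ _) h.eventuallyLE

lemma FF_le (hf : Integrable f ν) (hf0 : ∀ p, 0 ≤ f p) {l : ℝ} (hl : 0 ≤ l) :
    FF ν f l ≤ ∫ p, f p ∂ν := by
  apply integral_mono (FF_integrable hf hl) hf
  intro p; exact max_le (by linarith) (hf0 p)

lemma FF_anti (hf : Integrable f ν) {l l' : ℝ} (hl : 0 ≤ l) (h : l ≤ l') :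
    FF ν f l' ≤ FF ν f l := by
  apply integral_mono (FF_integrable hf (hl.trans h)) (FF_integrable hf hl)
  intro p; simp only; gcongr

lemma FF_tendsto_zero (hf : Integrable f ν) :
    Filter.Tendsto (fun l => FF ν f l) (nhdsWithin 0 (Set.Ioi 0)) (nhds (FF ν f 0)) := by
  unfold FF
  apply tendsto_integral_filter_of_dominated_convergence (fun p => |f p|)
  · filter_upwards [self_mem_nhdsWithin] with l hl
    exact (FF_integrable hf (le_of_lt hl)).aestronglyMeasurable
  · filter_upwards [self_mem_nhdsWithin] with l hl
    refine Filter.Eventually.of_forall fun p => ?_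
    have hl : 0 < l := hl
    rw [Real.norm_eq_abs, abs_of_nonneg (le_max_right _ _)]
    exact max_le (by linarith [le_abs_self (f p)]) (abs_nonneg _)
  · exact hf.abs
  · refine Filter.Eventually.of_forall fun p => ?_
    have : Continuous fun l : ℝ => max (f p - l) 0 := by fun_prop
    exact (this.tendsto 0).mono_left nhdsWithin_le_nhds

/-- set integral bound -/
lemma setInt_le (hf : Integrable f ν) (S : Set α) (hS' : ν S ≠ ⊤) {l : ℝ} (hl : 0 ≤ l) :
    ∫ p in S, f p ∂ν ≤ l * (ν S).toReal + FF ν f l := by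
  have h1 : ∫ p in S, f p ∂ν ≤ ∫ p in S, (l + max (f p - l) 0) ∂ν := by
    have hc : IntegrableOn (fun _ : α => l) S ν := integrableOn_const hS'
    apply integral_mono hf.integrableOn
    · exact hc.add (FF_integrable hf hl).integrableOn
    · intro p; simp only; linarith [le_max_left (f p - l) 0]
  have hc : IntegrableOn (fun _ : α => l) S ν := integrableOn_const hS'
  rw [integral_add hc (FF_integrable hf hl).integrableOn] at h1
  have h2 : ∫ p in S, max (f p - l) 0 ∂ν ≤ FF ν f l :=
    setIntegral_le_integral (FF_integrable hf hl)
      (Filter.Eventually.of_forall fun _ => le_max_right _ _)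
  simp [Measure.real] at h1
  linarith

lemma FF_ge (hf : Integrable f ν) (S : Set α) (hS : MeasurableSet S) (hS' : ν S ≠ ⊤) {l : ℝ}
    (hl : 0 ≤ l) :
    ∫ p in S, f p ∂ν - l * (ν S).toReal ≤ FF ν (S.indicator f) l := by
  rw [FF_ind S hS hl]
  have : ∫ p in S, (f p - l) ∂ν ≤ ∫ p in S, max (f p - l) 0 ∂ν := by
    apply integral_mono
    · exact hf.integrableOn.sub (integrableOn_const hS')
    · exact (FF_integrable hf hl).integrableOn
    · intro p; exact le_max_left _ _
  rw [integral_sub hf.integrableOn (integrableOn_const hS')] at this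
  simp [Measure.real] at this
  linarith

lemma FF_eq_ae (hf : Integrable f ν) (S : Set α) (hS : MeasurableSet S) (hS' : ν S ≠ ⊤) {l : ℝ}
    (hl : 0 ≤ l) (h : ∀ᵐ a ∂ν, a ∈ S → l ≤ f a) :
    FF ν (S.indicator f) l = ∫ p in S, f p ∂ν - l * (ν S).toReal := by
  rw [FF_ind S hS hl]
  have : ∫ p in S, max (f p - l) 0 ∂ν = ∫ p in S, (f p - l) ∂ν := by
    apply setIntegral_congr_ae hS
    filter_upwards [h] with p h hp
    simp [h hp]
  rw [this, integral_sub hf.integrableOn (integrableOn_const hS')]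
  simp [Measure.real]; ring

lemma FF_eq (hf : Integrable f ν) (S : Set α) (hS : MeasurableSet S) (hS' : ν S ≠ ⊤) {l : ℝ}
    (hl : 0 ≤ l) (h : ∀ a ∈ S, l ≤ f a) :
    FF ν (S.indicator f) l = ∫ p in S, f p ∂ν - l * (ν S).toReal :=
  FF_eq_ae hf S hS hS' hl (Filter.Eventually.of_forall h)

lemma FF_eq_zero (S : Set α) {l : ℝ}
    (hl : 0 ≤ l) (h : ∀ a ∈ S, f a ≤ l) : FF ν (S.indicator f) l = 0 := by
  unfold FF
  rw [← integral_zero α ℝ (μ := ν)]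
  congr 1; ext p
  by_cases hp : p ∈ S
  · simp [hp, h p hp]
  · simp [hp, hl]
lemma meas_gt_lt_top (hf : Integrable f ν) {l : ℝ} (hl : 0 < l) : ν {p | l < f p} < ⊤ := by
  refine lt_of_le_of_lt (measure_mono ?_) (hf.measure_norm_gt_lt_top hl)
  intro p hp
  simp only [Set.mem_ofPred_eq] at *
  exact lt_of_lt_of_le hp (le_abs_self _)

lemma FF_eq_zero_ae (S : Set α) {l : ℝ}
    (hl : 0 ≤ l) (h : ∀ᵐ a ∂ν, a ∈ S → f a ≤ l) : FF ν (S.indicator f) l = 0 := by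
  unfold FF
  rw [← integral_zero α ℝ (μ := ν)]
  apply integral_congr_ae
  filter_upwards [h] with p hp'
  by_cases hp : p ∈ S
  · simp [hp, hp' hp]
  · simp [hp, hl]
end generic
section rearrange
variable {α : Type*} [MeasurableSpace α] {ν : Measure α} {f g : α → ℝ}

lemma rearr_set_nonempty (hf : Integrable f ν) {t : ℝ} (ht : 0 < t) :
    {s : ℝ | 0 ≤ s ∧ ν {p | s < |f p|} ≤ ENNReal.ofReal t}.Nonempty := by
  set I := ∫⁻ p, ‖f p‖ₑ ∂ν with hI
  have hIt : I ≠ ⊤ := hf.hasFiniteIntegral.ne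
  have hpos : 0 < I.toReal / t + 1 := by positivity
  refine ⟨I.toReal / t + 1, hpos.le, ?_⟩
  have h := meas_ge_le_lintegral_div (μ := ν) (f := fun p => ‖f p‖ₑ)
    hf.aestronglyMeasurable.enorm (ε := ENNReal.ofReal (I.toReal / t + 1)) (by simpa using hpos)
    ENNReal.ofReal_ne_top
  refine le_trans (measure_mono ?_) (h.trans ?_)
  · intro p hp
    simp only [Set.mem_ofPred_eq] at *
    rw [← ofReal_norm]
    exact ENNReal.ofReal_le_ofReal hp.le
  · rw [← hI]
    apply ENNReal.div_le_of_le_mul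
    rw [← ENNReal.ofReal_mul ht.le, ← ENNReal.ofReal_toReal hIt]
    apply ENNReal.ofReal_le_ofReal
    rw [ENNReal.toReal_ofReal ENNReal.toReal_nonneg]
    field_simp
    linarith

lemma rearr_nonneg (t : ℝ) : 0 ≤ rearrM ν f t := Real.sInf_nonneg fun _ hs => hs.1

lemma rearr_lt (hf : Integrable f ν) {l t : ℝ} (hl : 0 ≤ l) (ht : 0 < t) :
    l < rearrM ν f t ↔ ENNReal.ofReal t < ν {p | l < |f p|} := by
  have bdd : BddBelow {s : ℝ | 0 ≤ s ∧ ν {p | s < |f p|} ≤ ENNReal.ofReal t} :=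
    ⟨0, fun s hs => hs.1⟩
  constructor
  · intro h
    by_contra hc
    push Not at hc
    exact absurd (csInf_le bdd ⟨hl, hc⟩) (not_le.mpr h)
  · intro h
    have hmono : Monotone fun n : ℕ => {p | l + 1 / ((n : ℝ) + 1) < |f p|} := by
      intro m n hmn p hp
      simp only [Set.mem_ofPred_eq] at *
      have := one_div_le_one_div_of_le (by positivity : (0:ℝ) < m + 1)
        (by exact_mod_cast Nat.succ_le_succ hmn : (m : ℝ) + 1 ≤ n + 1)
      linarith
    have hU : (⋃ n : ℕ, {p | l + 1 / ((n : ℝ) + 1) < |f p|}) = {p | l < |f p|} := by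
      ext p
      simp only [Set.mem_iUnion, Set.mem_ofPred_eq]
      constructor
      · rintro ⟨n, hn⟩
        have : (0:ℝ) < 1 / ((n : ℝ) + 1) := by positivity
        linarith
      · intro hp
        obtain ⟨n, hn⟩ := exists_nat_one_div_lt (sub_pos.mpr hp)
        exact ⟨n, by linarith⟩
    have ht' := tendsto_measure_iUnion_atTop (μ := ν) hmono
    rw [hU] at ht'
    obtain ⟨n, hn⟩ := (ht'.eventually (lt_mem_nhds h)).exists
    have : l + 1 / ((n : ℝ) + 1) ≤ rearrM ν f t := by
      apply le_csInf (rearr_set_nonempty hf ht)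
      intro s hs
      by_contra hc
      push Not at hc
      have : ν {p | l + 1 / ((n : ℝ) + 1) < |f p|} ≤ ν {p | s < |f p|} :=
        measure_mono fun p hp => lt_trans hc hp
      exact absurd (hn.trans_le (this.trans hs.2)) (lt_irrefl _)
    have h0 : (0:ℝ) < 1 / ((n : ℝ) + 1) := by positivity
    linarith

lemma rearr_anti (hf : Integrable f ν) : AntitoneOn (rearrM ν f) (Set.Ioi 0) := by
  intro s hs t ht hst
  have hs : 0 < s := hs
  have ht : 0 < t := ht
  by_contra hc
  push Not at hc
  rw [rearr_lt hf (rearr_nonneg _) ht] at hc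
  have : rearrM ν f s < rearrM ν f s := by
    rw [rearr_lt hf (rearr_nonneg _) hs]
    exact lt_of_le_of_lt (ENNReal.ofReal_le_ofReal hst) hc
  exact lt_irrefl _ this

lemma vol_lt (D : ENNReal) :
    (volume.restrict (Set.Ioi (0:ℝ))) {s | ENNReal.ofReal s < D} = D := by
  rw [Measure.restrict_apply' measurableSet_Ioi]
  by_cases hD : D = ⊤
  · have : {s : ℝ | ENNReal.ofReal s < D} ∩ Set.Ioi 0 = Set.Ioi 0 := by
      ext s; simp [hD]
    rw [this, hD]; simp
  · have : {s : ℝ | ENNReal.ofReal s < D} ∩ Set.Ioi 0 = Set.Ioo 0 D.toReal := by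
      ext s
      simp only [Set.mem_inter_iff, Set.mem_ofPred_eq, Set.mem_Ioi, Set.mem_Ioo]
      constructor
      · rintro ⟨h1, h2⟩
        exact ⟨h2, (ENNReal.ofReal_lt_iff_lt_toReal h2.le hD).1 h1⟩
      · rintro ⟨h1, h2⟩
        exact ⟨(ENNReal.ofReal_lt_iff_lt_toReal h1.le hD).2 h2, h1⟩
    rw [this]; simp [hD]

lemma rearr_lint (hf : Integrable f ν) (hf0 : ∀ p, 0 ≤ f p) {l : ℝ} (hl : 0 ≤ l) :
    ∫⁻ s in Set.Ioi (0:ℝ), ENNReal.ofReal (max (rearrM ν f s - l) 0) =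
      ∫⁻ p, ENNReal.ofReal (max (f p - l) 0) ∂ν := by
  have hm : AEMeasurable (rearrM ν f) (volume.restrict (Set.Ioi (0:ℝ))) :=
    aemeasurable_restrict_of_antitoneOn measurableSet_Ioi (rearr_anti hf)
  rw [lintegral_eq_lintegral_meas_lt _ (Filter.Eventually.of_forall fun s => (le_max_right _ _ : (0:ℝ) ≤ max (_ - l) 0))
      ((hm.sub_const l).max aemeasurable_const),
    lintegral_eq_lintegral_meas_lt _ (Filter.Eventually.of_forall fun s => (le_max_right _ _ : (0:ℝ) ≤ max (_ - l) 0))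
      (FF_integrable hf hl).aemeasurable]
  apply setLIntegral_congr_fun measurableSet_Ioi
  intro r hr
  have hr : 0 < r := hr
  simp only
  have e1 : {p | r < max (f p - l) 0} = {p | l + r < |f p|} := by
    ext p
    simp only [Set.mem_ofPred_eq, lt_max_iff, abs_of_nonneg (hf0 p)]
    constructor
    · rintro (h | h) <;> linarith
    · intro h; left; linarith
  rw [e1, ← vol_lt (ν {p | l + r < |f p|})]
  rw [Measure.restrict_apply' measurableSet_Ioi, Measure.restrict_apply' measurableSet_Ioi]
  congr 1
  ext s
  simp only [Set.mem_inter_iff, Set.mem_ofPred_eq, Set.mem_Ioi, lt_max_iff]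
  constructor
  · rintro ⟨h, hs⟩
    refine ⟨(rearr_lt hf (by linarith) hs).1 ?_, hs⟩
    rcases h with h | h <;> linarith
  · rintro ⟨h, hs⟩
    have := (rearr_lt hf (by linarith : 0 ≤ l + r) hs).2 h
    exact ⟨Or.inl (by linarith), hs⟩

lemma rearr_integrable (hf : Integrable f ν) (hf0 : ∀ p, 0 ≤ f p) :
    Integrable (rearrM ν f) (volume.restrict (Set.Ioi (0:ℝ))) := by
  have hm : AEMeasurable (rearrM ν f) (volume.restrict (Set.Ioi (0:ℝ))) :=
    aemeasurable_restrict_of_antitoneOn measurableSet_Ioi (rearr_anti hf)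
  refine ⟨hm.aestronglyMeasurable, ?_⟩
  rw [hasFiniteIntegral_iff_ofReal (Filter.Eventually.of_forall fun s => rearr_nonneg s)]
  have := rearr_lint hf hf0 le_rfl
  simp only [sub_zero, max_eq_left (rearr_nonneg _), max_eq_left (hf0 _)] at this
  rw [this]
  exact (hasFiniteIntegral_iff_ofReal (Filter.Eventually.of_forall hf0)).1 hf.hasFiniteIntegral

lemma rearr_FF (hf : Integrable f ν) (hf0 : ∀ p, 0 ≤ f p) {l : ℝ} (hl : 0 ≤ l) :
    FF (volume.restrict (Set.Ioi (0:ℝ))) (rearrM ν f) l = FF ν f l := by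
  unfold FF
  rw [integral_eq_lintegral_of_nonneg_ae (Filter.Eventually.of_forall fun s => (le_max_right _ _ : (0:ℝ) ≤ max (_ - l) 0))
      (FF_integrable (rearr_integrable hf hf0) hl).aestronglyMeasurable,
    integral_eq_lintegral_of_nonneg_ae (Filter.Eventually.of_forall fun s => (le_max_right _ _ : (0:ℝ) ≤ max (_ - l) 0))
      (FF_integrable hf hl).aestronglyMeasurable, rearr_lint hf hf0 hl]

lemma restr_eq (t : ℝ) : (volume.restrict (Set.Ioi (0:ℝ))).restrict (Set.Ioc 0 t) =
    volume.restrict (Set.Ioc 0 t) := by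
  rw [Measure.restrict_restrict measurableSet_Ioc]
  congr 1
  exact Set.inter_eq_left.2 fun s hs => hs.1

lemma meas_Ioc {t : ℝ} :
    (volume.restrict (Set.Ioi (0:ℝ))) (Set.Ioc 0 t) = ENNReal.ofReal t := by
  rw [← Measure.restrict_apply_univ, restr_eq]; simp

lemma rearr_int_le (hf : Integrable f ν) (hf0 : ∀ p, 0 ≤ f p) {l t : ℝ} (hl : 0 ≤ l)
    (ht : 0 ≤ t) : ∫ s in Set.Ioc 0 t, rearrM ν f s ≤ l * t + FF ν f l := by
  have := setInt_le (rearr_integrable hf hf0) (Set.Ioc 0 t)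
    (by rw [meas_Ioc]; exact ENNReal.ofReal_ne_top) hl
  rwa [rearr_FF hf hf0 hl, meas_Ioc, ENNReal.toReal_ofReal ht, restr_eq] at this

lemma rearr_int_eq (hf : Integrable f ν) (hf0 : ∀ p, 0 ≤ f p) {l t : ℝ} (hl : 0 ≤ l)
    (ht : 0 ≤ t) (h1 : ∀ s ∈ Set.Ioo 0 t, l ≤ rearrM ν f s)
    (h2 : ∀ s, t < s → rearrM ν f s ≤ l) :
    ∫ s in Set.Ioc 0 t, rearrM ν f s = l * t + FF ν f l := by
  have hi := rearr_integrable hf hf0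
  have e1 := FF_split hi (Set.Ioc 0 t) measurableSet_Ioc hl
  have h1' : ∀ᵐ s ∂(volume.restrict (Set.Ioi (0:ℝ))), s ∈ Set.Ioc 0 t → l ≤ rearrM ν f s := by
    have : ∀ᵐ s ∂(volume.restrict (Set.Ioi (0:ℝ))), s ≠ t := by
      rw [ae_iff]; simp
    filter_upwards [this] with s hs hs'
    exact h1 s ⟨hs'.1, lt_of_le_of_ne hs'.2 hs⟩
  rw [FF_eq_ae hi (Set.Ioc 0 t) measurableSet_Ioc
    (by rw [meas_Ioc]; exact ENNReal.ofReal_ne_top) hl h1'] at e1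
  rw [FF_eq_zero_ae _ hl, rearr_FF hf hf0 hl, meas_Ioc, ENNReal.toReal_ofReal ht, restr_eq] at e1
  · linarith
  · filter_upwards [ae_restrict_mem measurableSet_Ioi] with s hs hs'
    apply h2
    by_contra hc
    exact hs' ⟨hs, not_lt.1 hc⟩

lemma sub_of_FF {β : Type*} [MeasurableSpace β] {ν' : Measure β} {g : β → ℝ}
    (hf : Integrable f ν) (hf0 : ∀ p, 0 ≤ f p)
    (hg : Integrable g ν') (hg0 : ∀ p, 0 ≤ g p) (H : ∀ l, 0 ≤ l → FF ν f l ≤ FF ν' g l)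
    (t : ℝ) (ht : 0 ≤ t) :
    ∫ s in Set.Ioc 0 t, rearrM ν f s ≤ ∫ s in Set.Ioc 0 t, rearrM ν' g s := by
  rcases eq_or_lt_of_le ht with rfl | ht'
  · simp
  have hl : 0 ≤ rearrM ν' g t := rearr_nonneg t
  have := rearr_int_eq hg hg0 hl ht
    (fun s hs => rearr_anti hg hs.1 ht' hs.2.le)
    (fun s hs => rearr_anti hg ht' (ht'.trans hs) hs.le)
  rw [this]
  linarith [rearr_int_le hf hf0 hl ht, H _ hl]

lemma FF_of_sub {β : Type*} [MeasurableSpace β] {ν' : Measure β} {g : β → ℝ}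
    (hf : Integrable f ν) (hf0 : ∀ p, 0 ≤ f p)
    (hg : Integrable g ν') (hg0 : ∀ p, 0 ≤ g p)
    (H : ∀ t, 0 ≤ t → ∫ s in Set.Ioc 0 t, rearrM ν f s ≤ ∫ s in Set.Ioc 0 t, rearrM ν' g s)
    (l : ℝ) (hl : 0 ≤ l) : FF ν f l ≤ FF ν' g l := by
  have pos : ∀ l, 0 < l → FF ν f l ≤ FF ν' g l := by
    intro l hl
    set D := ν {p | l < |f p|} with hD
    have hDt : D ≠ ⊤ := by
      have := meas_gt_lt_top hf.abs hl
      exact this.ne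
    have ht : 0 ≤ D.toReal := ENNReal.toReal_nonneg
    have e := rearr_int_eq hf hf0 (l := l) hl.le ht ?_ ?_
    · linarith [H _ ht, rearr_int_le hg hg0 hl.le ht]
    · rintro s ⟨hs, h⟩
      exact ((rearr_lt hf hl.le hs).2
          ((ENNReal.ofReal_lt_iff_lt_toReal hs.le hDt).2 h)).le
    · intro s hs
      by_contra hc
      push Not at hc
      rw [rearr_lt hf hl.le (lt_of_le_of_lt ht hs)] at hc
      rw [← hD, ENNReal.ofReal_lt_iff_lt_toReal (lt_of_le_of_lt ht hs).le hDt] at hc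
      exact lt_irrefl _ (hc.trans hs)
  rcases eq_or_lt_of_le hl with rfl | hl
  · exact le_of_tendsto_of_tendsto (FF_tendsto_zero hf) (FF_tendsto_zero hg)
      (by filter_upwards [self_mem_nhdsWithin] with l hl using pos l hl)
  · exact pos l hl
end rearrange
lemma pos_cut (ρ : Measure ℝ) [NullSingletonClass ρ] (hfin : ∀ r, ρ (Set.Iio r) < ⊤) (h0 : ρ (Set.Iio 0) = 0)
    (e : ENNReal) (he : e < ρ Set.univ) : ∃ r : ℝ, 0 ≤ r ∧ ρ (Set.Iio r) = e := by
  set S := {r : ℝ | ρ (Set.Iio r) ≤ e} with hS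
  have hmono : ∀ {r s : ℝ}, r ≤ s → ρ (Set.Iio r) ≤ ρ (Set.Iio s) :=
    fun h => measure_mono (Set.Iio_subset_Iio h)
  have h0S : (0:ℝ) ∈ S := by simp [hS, h0]
  have hne : S.Nonempty := ⟨0, h0S⟩
  have hbdd : BddAbove S := by
    have hm : Monotone fun n : ℕ => Set.Iio (n : ℝ) := fun m n h =>
      Set.Iio_subset_Iio (by exact_mod_cast h)
    have hU : (⋃ n : ℕ, Set.Iio (n : ℝ)) = Set.univ := by
      ext x; simp only [Set.mem_iUnion, Set.mem_Iio, Set.mem_univ, iff_true]; exact exists_nat_gt x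
    have ht := tendsto_measure_iUnion_atTop (μ := ρ) hm
    rw [hU] at ht
    obtain ⟨n, hn⟩ := (ht.eventually (lt_mem_nhds he)).exists
    refine ⟨n, fun r hr => ?_⟩
    by_contra hc
    push Not at hc
    exact absurd (hn.trans_le ((hmono hc.le).trans hr)) (lt_irrefl _)
  refine ⟨sSup S, le_csSup hbdd h0S, le_antisymm ?_ ?_⟩
  · have hm : Monotone fun n : ℕ => Set.Iio (sSup S - 1 / ((n : ℝ) + 1)) := fun m n h => by
      apply Set.Iio_subset_Iio
      have := one_div_le_one_div_of_le (by positivity : (0:ℝ) < m + 1)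
        (by exact_mod_cast Nat.succ_le_succ h : (m : ℝ) + 1 ≤ n + 1)
      linarith
    have hU : (⋃ n : ℕ, Set.Iio (sSup S - 1 / ((n : ℝ) + 1))) = Set.Iio (sSup S) := by
      ext x; simp only [Set.mem_iUnion, Set.mem_Iio]
      constructor
      · rintro ⟨n, hn⟩
        have : (0:ℝ) < 1 / ((n : ℝ) + 1) := by positivity
        linarith
      · intro hp
        obtain ⟨n, hn⟩ := exists_nat_one_div_lt (sub_pos.mpr hp)
        exact ⟨n, by linarith⟩
    have ht := tendsto_measure_iUnion_atTop (μ := ρ) hm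
    rw [hU] at ht
    refine le_of_tendsto' ht fun n => ?_
    have : sSup S - 1 / ((n : ℝ) + 1) < sSup S := by
      have : (0:ℝ) < 1 / ((n : ℝ) + 1) := by positivity
      linarith
    obtain ⟨r, hr, hr'⟩ := exists_lt_of_lt_csSup hne this
    exact (hmono hr'.le).trans hr
  · have hm : Antitone fun n : ℕ => Set.Iio (sSup S + 1 / ((n : ℝ) + 1)) := fun m n h => by
      apply Set.Iio_subset_Iio
      have := one_div_le_one_div_of_le (by positivity : (0:ℝ) < m + 1)
        (by exact_mod_cast Nat.succ_le_succ h : (m : ℝ) + 1 ≤ n + 1)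
      linarith
    have hU : (⋂ n : ℕ, Set.Iio (sSup S + 1 / ((n : ℝ) + 1))) = Set.Iic (sSup S) := by
      ext x; simp only [Set.mem_iInter, Set.mem_Iio, Set.mem_Iic]
      constructor
      · intro h
        by_contra hc
        push Not at hc
        obtain ⟨n, hn⟩ := exists_nat_one_div_lt (sub_pos.mpr hc)
        have := h n
        linarith
      · intro h n
        have : (0:ℝ) < 1 / ((n : ℝ) + 1) := by positivity
        linarith
    have ht := tendsto_measure_iInter_atTop (μ := ρ) (fun n => measurableSet_Iio.nullMeasurableSet)
      hm ⟨0, (hfin _).ne⟩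
    rw [hU, measure_congr Iio_ae_eq_Iic.symm] at ht
    refine ge_of_tendsto' ht fun n => ?_
    by_contra hc
    push Not at hc
    have := le_csSup hbdd (show sSup S + 1 / ((n : ℝ) + 1) ∈ S from hc.le)
    have : (0:ℝ) < 1 / ((n : ℝ) + 1) := by positivity
    linarith

lemma mu0_cut (Z : Set ℝ) (e : ENNReal)
    (he : e ≤ (volume.restrict (Set.Ioi (0:ℝ))) Z) :
    ∃ r : EReal, (volume.restrict (Set.Ioi (0:ℝ))) (Z ∩ {p : ℝ | (p : EReal) < r}) = e := by
  rcases eq_or_lt_of_le he with h | h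
  · refine ⟨⊤, ?_⟩
    simp [h]
  · have f1 : ∀ r : ℝ, ((volume.restrict (Set.Ioi (0:ℝ))).restrict Z) (Set.Iio r) < ⊤ := by
      intro r
      refine lt_of_le_of_lt (Measure.restrict_apply_le _ _) ?_
      rw [Measure.restrict_apply measurableSet_Iio]
      refine lt_of_le_of_lt (measure_mono (t := Set.Ioo 0 r) fun p hp => ⟨hp.2, hp.1⟩) ?_
      simp
    have f2 : ((volume.restrict (Set.Ioi (0:ℝ))).restrict Z) (Set.Iio 0) = 0 := by
      refine le_antisymm (le_trans (Measure.restrict_apply_le _ _) ?_) zero_le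
      rw [Measure.restrict_apply measurableSet_Iio]
      have : Set.Iio (0:ℝ) ∩ Set.Ioi 0 = ∅ := by
        ext p; simp; intro h; exact h.le
      rw [this]; simp
    obtain ⟨r, -, hr⟩ := pos_cut _ f1 f2 e (by simpa using h)
    refine ⟨r, ?_⟩
    rw [Measure.restrict_apply measurableSet_Iio] at hr
    rw [← hr, Set.inter_comm]
    congr 2
    ext p; simp

lemma chain (y : ℝ → ℝ) (hm : Measurable y) (h0 : ∀ p, 0 ≤ y p)
    (hi : Integrable y (volume.restrict (Set.Ioi (0:ℝ)))) :
    ∃ T : ℝ → Set ℝ, ∃ lam : ℝ → ℝ,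
      (∀ t, 0 ≤ t → MeasurableSet (T t)) ∧
      (∀ t, 0 ≤ t → (volume.restrict (Set.Ioi (0:ℝ))) (T t) = ENNReal.ofReal t) ∧
      (∀ t, 0 < t → 0 ≤ lam t ∧ (∀ a ∈ T t, lam t ≤ y a) ∧ (∀ a ∉ T t, y a ≤ lam t)) ∧
      (∀ s t, 0 ≤ s → s ≤ t → T s ⊆ T t) := by
  set μ := volume.restrict (Set.Ioi (0:ℝ)) with hμ
  set lam := rearrM μ y with hlam
  have habs : ∀ l, {p | l < |y p|} = {p | l < y p} := fun l => by
    ext p; simp [abs_of_nonneg (h0 p)]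
  have hle : ∀ t, 0 < t → μ {p | lam t < y p} ≤ ENNReal.ofReal t := by
    intro t ht
    by_contra hc
    push Not at hc
    rw [← habs, ← rearr_lt hi (rearr_nonneg _) ht] at hc
    exact lt_irrefl _ hc
  have hge : ∀ t, 0 < t → ENNReal.ofReal t ≤ μ {p | lam t ≤ y p} := by
    intro t ht
    rcases eq_or_lt_of_le (rearr_nonneg (ν := μ) (f := y) t) with h | h
    · have : {p | lam t ≤ y p} = Set.univ := by
        ext p; simp [hlam, ← h, h0 p]
      rw [this]; simp [hμ]
    · have h : 0 < lam t := h
      have hanti : Antitone fun n : ℕ => {p | lam t - lam t / ((n : ℝ) + 2) < y p} := by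
        intro m n hmn p hp
        simp only [Set.mem_ofPred_eq] at *
        have := div_le_div_of_nonneg_left h.le (by positivity : (0:ℝ) < m + 2)
          (by have : (m : ℝ) ≤ n := by exact_mod_cast hmn
              linarith : (m : ℝ) + 2 ≤ n + 2)
        linarith
      have hU : (⋂ n : ℕ, {p | lam t - lam t / ((n : ℝ) + 2) < y p}) = {p | lam t ≤ y p} := by
        ext p; simp only [Set.mem_iInter, Set.mem_ofPred_eq]
        constructor
        · intro hp
          by_contra hc
          push Not at hc
          obtain ⟨n, hn⟩ := exists_nat_gt (lam t / (lam t - y p))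
          have h2 := hp n
          have h3 : 0 < lam t - y p := by linarith
          rw [div_lt_iff₀ h3] at hn
          have h4 : lam t / ((n : ℝ) + 2) ≤ lam t - y p := by
            rw [div_le_iff₀ (by positivity)]; nlinarith
          linarith
        · intro hp n
          have : 0 < lam t / ((n : ℝ) + 2) := by positivity
          linarith
      have hpos : ∀ n : ℕ, 0 < lam t - lam t / ((n : ℝ) + 2) := by
        intro n
        rw [sub_pos, div_lt_iff₀ (by positivity)]
        have : (0:ℝ) ≤ n := by positivity
        nlinarith
      have htd := tendsto_measure_iInter_atTop (μ := μ)
        (s := fun n : ℕ => {p | lam t - lam t / ((n : ℝ) + 2) < y p})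
        (fun n => (measurableSet_lt measurable_const hm).nullMeasurableSet) hanti
        ⟨0, (meas_gt_lt_top hi (hpos 0)).ne⟩
      rw [hU] at htd
      refine ge_of_tendsto' htd fun n => ?_
      have : lam t - lam t / ((n : ℝ) + 2) < rearrM μ y t := by
        have : 0 < lam t / ((n : ℝ) + 2) := by positivity
        show _ < lam t
        linarith
      rw [rearr_lt hi (hpos n).le ht, habs] at this
      exact this.le
  have hZ : ∀ t, MeasurableSet {p | y p = lam t} := fun t => hm (measurableSet_singleton _)
  have hcut : ∀ t, 0 < t → ∃ r : EReal, μ ({p | y p = lam t} ∩ {p : ℝ | (p : EReal) < r}) =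
      ENNReal.ofReal t - μ {p | lam t < y p} := by
    intro t ht
    apply mu0_cut _
    rw [tsub_le_iff_right]
    refine (hge t ht).trans (le_trans (measure_mono ?_) (measure_union_le _ _))
    intro p hp
    simp only [Set.mem_ofPred_eq, Set.mem_union] at *
    rcases eq_or_lt_of_le hp with h | h
    · exact Or.inl h.symm
    · exact Or.inr h
  choose! r hr using hcut
  have hJ : ∀ s : EReal, MeasurableSet {p : ℝ | (p : EReal) < s} := fun s =>
    measurable_coe_real_ereal measurableSet_Iio
  refine ⟨fun t => if 0 < t then {p | lam t < y p} ∪ ({p | y p = lam t} ∩ {p : ℝ | (p : EReal) < r t})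
    else ∅, lam, ?_, ?_, ?_, ?_⟩
  · intro t _
    simp only
    split_ifs
    · exact (measurableSet_lt measurable_const hm).union ((hZ t).inter (hJ _))
    · exact MeasurableSet.empty
  · intro t _
    simp only
    split_ifs with ht
    · rw [measure_union _ ((hZ t).inter (hJ _)), hr t ht]
      · exact add_tsub_cancel_of_le (hle t ht)
      · rw [Set.disjoint_left]
        rintro p hp ⟨hp', -⟩
        simp only [Set.mem_ofPred_eq] at *
        linarith
    · have : t = 0 := by linarith
      simp [this]
  · intro t ht
    simp only [ht, if_true]
    refine ⟨rearr_nonneg _, ?_, ?_⟩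
    · rintro a (ha | ha)
      · exact le_of_lt ha
      · exact ha.1.ge
    · intro a ha
      by_contra hc
      push Not at hc
      exact ha (Or.inl hc)
  · intro s t hs hst
    rcases eq_or_lt_of_le hs with rfl | hs
    · simp
    have ht : 0 < t := by linarith
    simp only [hs, ht, if_true]
    have hl : lam t ≤ lam s := rearr_anti hi hs ht hst
    rcases eq_or_lt_of_le hst with rfl | hst
    · exact le_rfl
    rcases eq_or_lt_of_le hl with h | h
    · rw [h]
      apply Set.union_subset_union_right
      apply Set.inter_subset_inter_right
      have hrr : r s ≤ r t := by
        by_contra hc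
        push Not at hc
        have h1 : μ ({p | y p = lam t} ∩ {p : ℝ | (p : EReal) < r t}) ≤
          μ ({p | y p = lam t} ∩ {p : ℝ | (p : EReal) < r s}) :=
          measure_mono (Set.inter_subset_inter_right _ fun p hp => lt_trans hp hc)
        rw [hr t ht, h, hr s hs] at h1
        have h2 : ENNReal.ofReal t ≤ ENNReal.ofReal s := by
          have e1 := add_tsub_cancel_of_le (hle t ht)
          have e2 := add_tsub_cancel_of_le (hle s hs)
          rw [h] at e1
          rw [← e1, ← e2]
          gcongr
        rw [ENNReal.ofReal_le_ofReal_iff hs.le] at h2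
        linarith
      intro p hp
      exact lt_of_lt_of_le hp hrr
    · intro p hp
      left
      rcases hp with hp | hp
      · exact lt_trans h hp
      · show lam t < y p
        rw [hp.1]; exact h
lemma FF_tendsto_atTop {α : Type*} [MeasurableSpace α] {ν : Measure α} {f : α → ℝ}
    (hf : Integrable f ν) :
    Filter.Tendsto (fun l => FF ν f l) Filter.atTop (nhds 0) := by
  have : (0:ℝ) = ∫ p, (0:ℝ) ∂ν := by simp
  rw [this]
  unfold FF
  apply tendsto_integral_filter_of_dominated_convergence (fun p => |f p|)
  · filter_upwards [Filter.eventually_ge_atTop 0] with l hl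
    exact (FF_integrable hf hl).aestronglyMeasurable
  · filter_upwards [Filter.eventually_ge_atTop 0] with l hl
    refine Filter.Eventually.of_forall fun p => ?_
    rw [Real.norm_eq_abs, abs_of_nonneg (le_max_right _ _)]
    exact max_le (by linarith [le_abs_self (f p)]) (abs_nonneg _)
  · exact hf.abs
  · refine Filter.Eventually.of_forall fun p => ?_
    apply tendsto_const_nhds.congr'
    filter_upwards [Filter.eventually_ge_atTop (f p)] with l hl
    rw [max_eq_right]; linarith

/-- A chain of upper level sets. -/
structure IsChn (μ : Measure ℝ) (y : ℝ → ℝ) (T : ℝ → Set ℝ) (lam : ℝ → ℝ) : Prop where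
  int : Integrable y μ
  nn : ∀ p, 0 ≤ y p
  meas : ∀ t, 0 ≤ t → MeasurableSet (T t)
  vol : ∀ t, 0 ≤ t → μ (T t) = ENNReal.ofReal t
  lev : ∀ t, 0 < t → 0 ≤ lam t ∧ (∀ a ∈ T t, lam t ≤ y a) ∧ (∀ a ∉ T t, y a ≤ lam t)
  mono : ∀ s t, 0 ≤ s → s ≤ t → T s ⊆ T t

namespace IsChn
variable {μ : Measure ℝ} {x y : ℝ → ℝ} {T : ℝ → Set ℝ} {lam : ℝ → ℝ}

lemma ne_top (h : IsChn μ y T lam) {t : ℝ} (ht : 0 ≤ t) : μ (T t) ≠ ⊤ := by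
  rw [h.vol t ht]; exact ENNReal.ofReal_ne_top

lemma toR (h : IsChn μ y T lam) {t : ℝ} (ht : 0 ≤ t) : (μ (T t)).toReal = t := by
  rw [h.vol t ht, ENNReal.toReal_ofReal ht]

lemma Y0 (h : IsChn μ y T lam) : ∫ p in T 0, y p ∂μ = 0 := by
  have : μ (T 0) = 0 := by rw [h.vol 0 le_rfl]; simp
  rw [Measure.restrict_eq_zero.2 this]; simp

lemma ind_hi (h : IsChn μ y T lam) {t l : ℝ} (ht : 0 < t) (hl : lam t ≤ l) :
    FF μ ((T t)ᶜ.indicator y) l = 0 :=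
  FF_eq_zero _ ((h.lev t ht).1.trans hl) fun a ha => ((h.lev t ht).2.2 a ha).trans hl

lemma ind_lo (h : IsChn μ y T lam) {t l : ℝ} (ht : 0 < t) (h0 : 0 ≤ l) (hl : l ≤ lam t) :
    FF μ ((T t).indicator y) l = ∫ p in T t, y p ∂μ - l * t := by
  rw [FF_eq h.int _ (h.meas t ht.le) (h.ne_top ht.le) h0
    (fun a ha => hl.trans ((h.lev t ht).2.1 a ha)), h.toR ht.le]

lemma Yeq (h : IsChn μ y T lam) {t : ℝ} (ht : 0 < t) :
    FF μ y (lam t) = ∫ p in T t, y p ∂μ - lam t * t := by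
  rw [FF_split h.int _ (h.meas t ht.le) (h.lev t ht).1, h.ind_hi ht le_rfl,
    h.ind_lo ht (h.lev t ht).1 le_rfl, add_zero]

lemma Yle (h : IsChn μ y T lam) {t l : ℝ} (ht : 0 ≤ t) (hl : 0 ≤ l) :
    ∫ p in T t, y p ∂μ ≤ l * t + FF μ y l := by
  have := setInt_le h.int (T t) (h.ne_top ht) hl
  rwa [h.toR ht] at this

lemma Ymax (h : IsChn μ y T lam) (hx : Integrable x μ) (H : ∀ l, 0 ≤ l → FF μ x l ≤ FF μ y l)
    (S : Set ℝ) (hS : μ S ≠ ⊤) : ∫ p in S, x p ∂μ ≤ ∫ p in T (μ S).toReal, y p ∂μ := by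
  rcases eq_or_lt_of_le (ENNReal.toReal_nonneg (a := μ S)) with e | e
  · rw [← e, h.Y0]
    have : μ S = 0 := by
      rcases (ENNReal.toReal_eq_zero_iff _).1 e.symm with h | h
      · exact h
      · exact absurd h hS
    rw [Measure.restrict_eq_zero.2 this]; simp
  · have h1 := setInt_le hx S hS (h.lev _ e).1
    have h2 := H _ (h.lev _ e).1
    have h3 := h.Yeq e
    linarith

lemma mdiff (h : IsChn μ y T lam) {s t : ℝ} (hs : 0 ≤ s) (hst : s ≤ t) :
    μ (T t \ T s) = ENNReal.ofReal (t - s) := by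
  rw [measure_sdiff (h.mono s t hs hst) (h.meas s hs).nullMeasurableSet (h.ne_top hs),
    h.vol t (hs.trans hst), h.vol s hs, ENNReal.ofReal_sub _ hs]

lemma Ydiff (h : IsChn μ y T lam) {s t : ℝ} (hs : 0 ≤ s) (hst : s ≤ t) :
    ∫ p in T t \ T s, y p ∂μ = ∫ p in T t, y p ∂μ - ∫ p in T s, y p ∂μ :=
  setIntegral_sdiff (h.meas s hs) h.int.integrableOn (h.mono s t hs hst)

lemma Ymod (h : IsChn μ y T lam) {s t l : ℝ} (hs : 0 ≤ s) (hst : s ≤ t) (hl : 0 ≤ l) :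
    0 ≤ ∫ p in T t, y p ∂μ - ∫ p in T s, y p ∂μ ∧
    ∫ p in T t, y p ∂μ - ∫ p in T s, y p ∂μ ≤ l * (t - s) + FF μ y l := by
  rw [← h.Ydiff hs hst]
  refine ⟨integral_nonneg h.nn, ?_⟩
  have := setInt_le h.int (T t \ T s) (by rw [h.mdiff hs hst]; exact ENNReal.ofReal_ne_top) hl
  rwa [h.mdiff hs hst, ENNReal.toReal_ofReal (by linarith)] at this

lemma Ycont (h : IsChn μ y T lam) :
    ContinuousOn (fun t => ∫ p in T t, y p ∂μ) (Set.Ici 0) := by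
  rw [Metric.continuousOn_iff]
  intro b hb ε hε
  have h1 := (FF_tendsto_atTop h.int).eventually (gt_mem_nhds (half_pos hε))
  obtain ⟨l, hl1, hl0⟩ := (h1.and (Filter.eventually_ge_atTop 0)).exists
  refine ⟨ε / (2 * (l + 1)), by positivity, ?_⟩
  intro a ha hab
  have hd : l * |a - b| < ε / 2 := by
    rw [Real.dist_eq, lt_div_iff₀ (by positivity)] at hab
    nlinarith [abs_nonneg (a - b)]
  rw [Real.dist_eq]
  rcases le_total a b with hle | hle
  · have := h.Ymod ha hle hl0
    rw [abs_sub_comm, abs_of_nonneg this.1]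
    rw [abs_sub_comm, abs_of_nonneg (by linarith)] at hd
    linarith
  · have := h.Ymod hb hle hl0
    rw [abs_of_nonneg this.1]
    rw [abs_of_nonneg (by linarith)] at hd
    linarith

lemma H1 (h : IsChn μ y T lam) (hx : Integrable x μ) (H : ∀ l, 0 ≤ l → FF μ x l ≤ FF μ y l)
    {t k l : ℝ} (ht : 0 ≤ t) (hk : 0 ≤ k) (hroot : ∫ p in T t, y p ∂μ - k * t = FF μ x k)
    (hl : k ≤ l) : FF μ x l ≤ FF μ ((T t).indicator y) l := by
  rcases eq_or_lt_of_le ht with rfl | ht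
  · rw [h.Y0] at hroot
    have := FF_anti hx hk hl
    have := FF_nonneg (ν := μ) (f := (T 0).indicator y) l
    linarith
  have hl0 : 0 ≤ l := hk.trans hl
  rcases le_total (lam t) l with hc | hc
  · have := FF_split h.int _ (h.meas t ht.le) hl0
    rw [h.ind_hi ht hc] at this
    linarith [H l hl0]
  · rw [h.ind_lo ht hl0 hc]
    apply FF_chord hx hk hl hc hroot.ge
    rw [← h.Yeq ht]
    exact H _ (h.lev t ht).1

lemma H2 (h : IsChn μ y T lam) (hx : Integrable x μ) (H : ∀ l, 0 ≤ l → FF μ x l ≤ FF μ y l)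
    {t k l : ℝ} (ht : 0 ≤ t) (hl0 : 0 ≤ l) (hroot : ∫ p in T t, y p ∂μ - k * t = FF μ x k)
    (hl : l ≤ k) : FF μ x l ≤ ∫ p in T t, y p ∂μ - l * t + FF μ ((T t)ᶜ.indicator y) l := by
  have hs := FF_split h.int _ (h.meas t ht) hl0
  rcases eq_or_lt_of_le ht with rfl | ht
  · rw [FF_ind _ (h.meas 0 le_rfl) hl0] at hs
    have : μ (T 0) = 0 := by rw [h.vol 0 le_rfl]; simp
    rw [Measure.restrict_eq_zero.2 this] at hs ⊢
    simp at hs ⊢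
    rw [← hs]; exact H l hl0
  rcases le_total l (lam t) with hc | hc
  · rw [← h.ind_lo ht hl0 hc, ← hs]; exact H l hl0
  · have := FF_nonneg (ν := μ) (f := (T t)ᶜ.indicator y) l
    have h2 : FF μ x l ≤ ∫ p in T t, y p ∂μ - l * t := by
      apply FF_chord hx (h.lev t ht).1 hc hl _ hroot.ge
      rw [← h.Yeq ht]
      exact H _ (h.lev t ht).1
    linarith
end IsChn

lemma chain' (y : ℝ → ℝ) (hm : Measurable y) (h0 : ∀ p, 0 ≤ y p)
    (hi : Integrable y (volume.restrict (Set.Ioi (0:ℝ)))) :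
    ∃ T lam, IsChn (volume.restrict (Set.Ioi (0:ℝ))) y T lam := by
  obtain ⟨T, lam, h1, h2, h3, h4⟩ := chain y hm h0 hi
  exact ⟨T, lam, hi, h0, h1, h2, h3, h4⟩

lemma trunc (x y : ℝ → ℝ) (hxi : Integrable x (volume.restrict (Set.Ioi (0:ℝ))))
    (hx0 : ∀ p, 0 ≤ x p)
    (hm : Measurable y) (h0 : ∀ p, 0 ≤ y p)
    (hi : Integrable y (volume.restrict (Set.Ioi (0:ℝ))))
    (H : ∀ l, 0 ≤ l → FF (volume.restrict (Set.Ioi (0:ℝ))) x l ≤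
      FF (volume.restrict (Set.Ioi (0:ℝ))) y l) :
    ∃ C, MeasurableSet C ∧ (∀ l, 0 ≤ l → FF (volume.restrict (Set.Ioi (0:ℝ))) x l ≤
      FF (volume.restrict (Set.Ioi (0:ℝ))) (C.indicator y) l) ∧
      ∫ p in Set.Ioi (0:ℝ), x p = ∫ p in C, y p ∂(volume.restrict (Set.Ioi (0:ℝ))) := by
  set μ := volume.restrict (Set.Ioi (0:ℝ)) with hμ
  rcases eq_or_lt_of_le (H 0 le_rfl) with e | e
  · refine ⟨Set.univ, MeasurableSet.univ, ?_, ?_⟩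
    · simpa using H
    · rw [FF_zero hx0, FF_zero h0] at e
      simpa using e
  obtain ⟨T, lam, h⟩ := chain' y hm h0 hi
  obtain ⟨l, hl1, hl0⟩ := (((FF_tendsto_zero hi).eventually (lt_mem_nhds e)).and
    self_mem_nhdsWithin).exists
  have hl0 : 0 < l := hl0
  have hS : μ {p | l < y p} ≠ ⊤ := (meas_gt_lt_top hi hl0).ne
  have hbig : FF μ x 0 ≤ ∫ p in T (μ {p | l < y p}).toReal, y p ∂μ := by
    have h1 := h.Ymax hi (fun _ _ => le_rfl) _ hS
    have hSm : MeasurableSet {p | l < y p} := measurableSet_lt measurable_const hm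
    have h2 := FF_eq hi _ hSm hS hl0.le (fun a ha => le_of_lt ha)
    have h3 := FF_split hi _ hSm hl0.le
    rw [FF_eq_zero ({p | l < y p}ᶜ) hl0.le
      (fun a ha => by have h' : ¬ (l < y a) := ha; exact not_lt.1 h')] at h3
    have : 0 ≤ l * (μ {p | l < y p}).toReal := by positivity
    linarith
  obtain ⟨t, ⟨ht0, -⟩, ht⟩ := intermediate_value_Icc (ENNReal.toReal_nonneg (a := μ {p | l < y p}))
    (h.Ycont.mono Set.Icc_subset_Ici_self) ⟨by rw [h.Y0]; exact FF_nonneg _, hbig⟩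
  simp only at ht
  refine ⟨T t, h.meas t ht0, fun l hl => h.H1 hxi H ht0 le_rfl (by rw [← ht]; ring) hl, ?_⟩
  rw [ht, FF_zero hx0]

lemma step (x y : ℝ → ℝ) (hxm : Measurable x) (hx0 : ∀ p, 0 ≤ x p)
    (hxi : Integrable x (volume.restrict (Set.Ioi (0:ℝ))))
    (hm : Measurable y) (h0 : ∀ p, 0 ≤ y p)
    (hi : Integrable y (volume.restrict (Set.Ioi (0:ℝ))))
    (H : ∀ l, 0 ≤ l → FF (volume.restrict (Set.Ioi (0:ℝ))) x l ≤
      FF (volume.restrict (Set.Ioi (0:ℝ))) y l) (k : ℝ) (hk : 0 < k) :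
    ∃ A, MeasurableSet A ∧ (volume.restrict (Set.Ioi (0:ℝ))) A < ⊤ ∧
      (∀ l, 0 ≤ l → FF (volume.restrict (Set.Ioi (0:ℝ))) ({p | k < x p}.indicator x) l ≤
        FF (volume.restrict (Set.Ioi (0:ℝ))) (A.indicator y) l) ∧
      (∀ l, 0 ≤ l → FF (volume.restrict (Set.Ioi (0:ℝ))) ({p | k < x p}ᶜ.indicator x) l ≤
        FF (volume.restrict (Set.Ioi (0:ℝ))) (Aᶜ.indicator y) l) ∧
      ∫ p in {p | k < x p}, x p ∂(volume.restrict (Set.Ioi (0:ℝ))) =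
        ∫ p in A, y p ∂(volume.restrict (Set.Ioi (0:ℝ))) := by
  set μ := volume.restrict (Set.Ioi (0:ℝ)) with hμ
  obtain ⟨T, lam, h⟩ := chain' y hm h0 hi
  set B := {p | k < x p} with hB
  have hBm : MeasurableSet B := measurableSet_lt measurable_const hxm
  have hBf : μ B ≠ ⊤ := (meas_gt_lt_top hxi hk).ne
  set b := (μ B).toReal with hb
  have hb0 : 0 ≤ b := ENNReal.toReal_nonneg
  set Y : ℝ → ℝ := fun t => ∫ p in T t, y p ∂μ with hY
  have hY0 : Y 0 = 0 := h.Y0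
  have hlo : ∀ l, 0 ≤ l → l ≤ k → FF μ (B.indicator x) l = ∫ p in B, x p ∂μ - l * b := by
    intro l hl hlk
    exact FF_eq hxi B hBm hBf hl fun a ha => hlk.trans (le_of_lt ha)
  have hhi : ∀ l, k ≤ l → FF μ (Bᶜ.indicator x) l = 0 := by
    intro l hl
    exact FF_eq_zero _ (hk.le.trans hl) fun a ha => by
      have h' : ¬ (k < x a) := ha
      exact (not_lt.1 h').trans hl
  have hsp : ∀ l, 0 ≤ l → FF μ x l = FF μ (B.indicator x) l + FF μ (Bᶜ.indicator x) l :=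
    fun l hl => FF_split hxi B hBm hl
  have hFk : FF μ x k = ∫ p in B, x p ∂μ - k * b := by
    rw [hsp k hk.le, hlo k hk.le le_rfl, hhi k le_rfl, add_zero]
  have hYb : ∫ p in B, x p ∂μ ≤ Y b := h.Ymax hxi H B hBf
  have hFk0 : 0 ≤ FF μ x k := FF_nonneg _
  have hYc : ContinuousOn Y (Set.Ici 0) := h.Ycont
  have hGc : ContinuousOn (fun t => Y t - k * t) (Set.Ici 0) := hYc.sub (by fun_prop)
  obtain ⟨a, ⟨ha0, hab⟩, ha⟩ := intermediate_value_Icc hb0 (hGc.mono Set.Icc_subset_Ici_self)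
    (show FF μ x k ∈ Set.Icc (Y 0 - k * 0) (Y b - k * b) by
      rw [hY0]; constructor <;> linarith)
  set M := max b ((∫ p, y p ∂μ) / k) with hM
  have hMk : Y M - k * M ≤ 0 := by
    have h1 : Y M ≤ ∫ p, y p ∂μ := setIntegral_le_integral hi (Filter.Eventually.of_forall h0)
    have h2 : (∫ p, y p ∂μ) / k ≤ M := le_max_right _ _
    rw [div_le_iff₀ hk] at h2
    linarith
  obtain ⟨c, ⟨hbc, hcM⟩, hc⟩ := intermediate_value_Icc' (le_max_left b ((∫ p, y p ∂μ) / k))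
    (hGc.mono (fun t ht => hb0.trans ht.1 : Set.Icc b M ⊆ Set.Ici 0))
    (show FF μ x k ∈ Set.Icc (Y M - k * M) (Y b - k * b) by constructor <;> linarith)
  simp only at ha hc
  set w := b - a with hw
  have hc0 : 0 ≤ c := hb0.trans hbc
  -- concavity
  have hconc : ∀ t, a ≤ t → t ≤ c → FF μ x k ≤ Y t - k * t := by
    intro t h1 h2
    rcases eq_or_lt_of_le (ha0.trans h1) with e | e
    · have : a = 0 := by linarith
      rw [← e, ← ha, this]
    have e1 : FF μ y (lam t) = Y t - lam t * t := h.Yeq e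
    have e2 : Y a ≤ lam t * a + FF μ y (lam t) := h.Yle ha0 (h.lev t e).1
    have e3 : Y c ≤ lam t * c + FF μ y (lam t) := h.Yle hc0 (h.lev t e).1
    rcases le_total k (lam t) with hh | hh <;> nlinarith
  obtain ⟨d, ⟨hd1, hd2⟩, hd⟩ : ∃ d ∈ Set.Icc a (c - w), Y (d + w) - Y d = k * w := by
    have hcont : ContinuousOn (fun t => Y (t + w) - Y t) (Set.Icc a (c - w)) := by
      apply ContinuousOn.sub
      · apply hYc.comp (by fun_prop)
        intro t ht
        have := ht.1
        simp only [Set.mem_Ici]; linarith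
      · exact hYc.mono fun t ht => ha0.trans ht.1
    apply intermediate_value_Icc' (by linarith) hcont
    constructor
    · have h1 := hconc (c - w) (by linarith) (by linarith)
      simp only [sub_add_cancel]
      nlinarith
    · have : a + w = b := by linarith
      simp only [this]
      nlinarith
  have hw0 : 0 ≤ w := by linarith
  have hd0 : 0 ≤ d := by linarith
  set W := T (d + w) \ T d with hW
  have hWm : MeasurableSet W := (h.meas _ (by linarith)).diff (h.meas _ hd0)
  have hTa := h.meas a ha0
  have hTc := h.meas c hc0
  have hWv : μ W = ENNReal.ofReal w := by
    rw [hW, h.mdiff hd0 (by linarith)]; congr 1; ring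
  have hWi : ∫ p in W, y p ∂μ = k * w := by
    rw [hW, h.Ydiff hd0 (by linarith)]; exact hd
  have hdisj : Disjoint (T a) W := by
    rw [Set.disjoint_left]
    intro p hp hp'
    exact hp'.2 (h.mono a d ha0 hd1 hp)
  have hWc : W ⊆ T c := fun p hp => h.mono (d + w) c (by linarith) (by linarith) hp.1
  have hac : T a ⊆ T c := h.mono a c ha0 (by linarith)
  have hAi : ∫ p in T a ∪ W, y p ∂μ = Y a + k * w := by
    rw [setIntegral_union hdisj hWm hi.integrableOn hi.integrableOn, hWi]
  have hAv : μ (T a ∪ W) = ENNReal.ofReal b := by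
    rw [measure_union hdisj hWm, hWv, h.vol a ha0, ← ENNReal.ofReal_add ha0 hw0]; congr 1; ring
  have hAm : MeasurableSet (T a ∪ W) := hTa.union hWm
  have hmass : ∫ p in B, x p ∂μ = ∫ p in T a ∪ W, y p ∂μ := by
    rw [hAi]; nlinarith
  refine ⟨T a ∪ W, hAm, ?_, ?_, ?_, hmass⟩
  · rw [hAv]; exact ENNReal.ofReal_lt_top
  · intro l hl
    rcases le_total l k with hlk | hlk
    · rw [hlo l hl hlk, hmass]
      have := FF_ge hi _ hAm (by rw [hAv]; exact ENNReal.ofReal_ne_top) hl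
      rwa [hAv, ENNReal.toReal_ofReal hb0] at this
    · have h1 := h.H1 hxi H ha0 hk.le ha hlk
      have h2 := FF_ind_mono hi hTa hAm Set.subset_union_left hl
      have h3 := hsp l hl
      rw [hhi l hlk] at h3
      linarith
  · intro l hl
    rcases le_total k l with hlk | hlk
    · rw [hhi l hlk]; exact FF_nonneg _
    have h1 := h.H2 hxi H hc0 hl hc hlk
    have h2 := hsp l hl
    rw [hlo l hl hlk, hmass, hAi] at h2
    -- complement of A contains T c \ A and the complement of T c
    set V := T c \ (T a ∪ W) with hV
    have hVm : MeasurableSet V := hTc.diff hAm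
    have hAc : T a ∪ W ⊆ T c := Set.union_subset hac hWc
    have hVv : μ V = ENNReal.ofReal (c - b) := by
      rw [hV, measure_sdiff hAc hAm.nullMeasurableSet (by rw [hAv]; exact ENNReal.ofReal_ne_top),
        hAv, h.vol c hc0, ENNReal.ofReal_sub _ hb0]
    have hVi : ∫ p in V, y p ∂μ = Y c - (Y a + k * w) := by
      rw [hV, setIntegral_sdiff hAm hi.integrableOn hAc, hAi]
    have h3 := FF_ge hi V hVm (by rw [hVv]; exact ENNReal.ofReal_ne_top) hl
    rw [hVv, ENNReal.toReal_ofReal (by linarith), hVi] at h3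
    have h4 : FF μ ((T a ∪ W)ᶜ.indicator y) l =
        FF μ (V.indicator y) l + FF μ ((T c)ᶜ.indicator y) l := by
      rw [FF_ind _ hAm.compl hl, FF_ind _ hVm hl, FF_ind _ hTc.compl hl, ← setIntegral_union]
      · congr 2
        ext p
        simp only [hV, Set.mem_compl_iff, Set.mem_union, Set.mem_sdiff]
        have := @hWc p
        have := @hac p
        tauto
      · rw [Set.disjoint_left]
        intro p hp hp'
        exact hp' hp.1
      · exact hTc.compl
      · exact (FF_integrable hi hl).integrableOn
      · exact (FF_integrable hi hl).integrableOn
    have e : (∫ p in T c, y p ∂μ) = Y c := rfl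
    rw [e] at h1
    rw [h4]
    nlinarith
/-- Lebesgue measure on the half line. -/
noncomputable abbrev mu0 : Measure ℝ := volume.restrict (Set.Ioi (0:ℝ))

lemma lemP_step (x y : ℝ → ℝ) (hxm : Measurable x) (hx0 : ∀ p, 0 ≤ x p)
    (hxi : Integrable x mu0) (hm : Measurable y) (h0 : ∀ p, 0 ≤ y p) (hi : Integrable y mu0)
    (n : ℕ) (U : Set ℝ) (hU : MeasurableSet U)
    (H : ∀ l, 0 ≤ l → FF mu0 ({p | 1 < (n : ℝ) * x p}ᶜ.indicator x) l ≤
      FF mu0 (Uᶜ.indicator y) l) :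
    ∃ A, MeasurableSet A ∧ A ⊆ Uᶜ ∧ mu0 A < ⊤ ∧
      (∀ l, 0 ≤ l → FF mu0 (({p | 1 < ((n + 1 : ℕ) : ℝ) * x p} \ {p | 1 < (n : ℝ) * x p}).indicator x) l
        ≤ FF mu0 (A.indicator y) l) ∧
      (∀ l, 0 ≤ l → FF mu0 ({p | 1 < ((n + 1 : ℕ) : ℝ) * x p}ᶜ.indicator x) l ≤
        FF mu0 ((U ∪ A)ᶜ.indicator y) l) ∧
      ∫ p in {p | 1 < ((n + 1 : ℕ) : ℝ) * x p} \ {p | 1 < (n : ℝ) * x p}, x p ∂mu0 =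
        ∫ p in A, y p ∂mu0 := by
  set V : Set ℝ := {p | 1 < (n : ℝ) * x p} with hV
  set V' : Set ℝ := {p | 1 < ((n + 1 : ℕ) : ℝ) * x p} with hV'
  have hVm : MeasurableSet V := measurableSet_lt measurable_const (hxm.const_mul _)
  have hk : (0:ℝ) < 1 / ((n:ℝ) + 1) := by positivity
  have hVV : V ⊆ V' := by
    intro p hp
    have hp : 1 < (n : ℝ) * x p := hp
    show 1 < ((n + 1 : ℕ) : ℝ) * x p
    push_cast
    nlinarith [hx0 p]
  have hD : {p | 1 / ((n:ℝ) + 1) < Vᶜ.indicator x p} = V' \ V := by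
    ext p
    simp only [Set.mem_ofPred_eq, Set.mem_sdiff]
    by_cases hp : p ∈ V
    · have : Vᶜ.indicator x p = 0 := by simp [hp]
      rw [this]
      simp only [hp, not_true, and_false, iff_false, not_lt]
      exact hk.le
    · have : Vᶜ.indicator x p = x p := by simp [hp]
      rw [this]
      simp only [hp, not_false_iff, and_true]
      show _ ↔ 1 < ((n + 1 : ℕ) : ℝ) * x p
      rw [div_lt_iff₀ (by positivity)]
      push_cast
      rw [mul_comm]
  obtain ⟨A, hA, hAf, h1, h2, h3⟩ := step (Vᶜ.indicator x) (Uᶜ.indicator y)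
    (hxm.indicator hVm.compl) (fun p => Set.indicator_nonneg (fun p _ => hx0 p) p)
    (hxi.indicator hVm.compl) (hm.indicator hU.compl)
    (fun p => Set.indicator_nonneg (fun p _ => h0 p) p) (hi.indicator hU.compl) H _ hk
  rw [hD] at h1 h2 h3
  have q1 : (V' \ V) ∩ Vᶜ = V' \ V := by
    ext p; simp only [Set.mem_sdiff, Set.mem_inter_iff, Set.mem_compl_iff]; tauto
  have q2 : (V' \ V)ᶜ ∩ Vᶜ = V'ᶜ := by
    ext p; simp only [Set.mem_sdiff, Set.mem_inter_iff, Set.mem_compl_iff]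
    have := @hVV p
    tauto
  have q3 : Aᶜ ∩ Uᶜ = (U ∪ A ∩ Uᶜ)ᶜ := by
    ext p; simp only [Set.mem_union, Set.mem_inter_iff, Set.mem_compl_iff]; tauto
  refine ⟨A ∩ Uᶜ, hA.inter hU.compl, Set.inter_subset_right,
    lt_of_le_of_lt (measure_mono Set.inter_subset_left) hAf, ?_, ?_, ?_⟩
  · intro l hl
    have := h1 l hl
    rwa [Set.indicator_indicator, Set.indicator_indicator, q1] at this
  · intro l hl
    have := h2 l hl
    rwa [Set.indicator_indicator, Set.indicator_indicator, q2, q3] at this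
  · rw [setIntegral_indicator hU.compl, setIntegral_indicator hVm.compl] at h3
    rwa [q1] at h3

lemma ae_zero_off {y : ℝ → ℝ} (h0 : ∀ p, 0 ≤ y p) (hi : Integrable y mu0) {U : Set ℝ}
    (hU : MeasurableSet U) (h : ∫ p in U, y p ∂mu0 = ∫ p, y p ∂mu0) :
    ∀ᵐ p ∂mu0, p ∉ U → y p = 0 := by
  have h1 := integral_add_compl hU hi
  have h2 : ∫ p in Uᶜ, y p ∂mu0 = 0 := by linarith
  rw [setIntegral_eq_zero_iff_of_nonneg_ae (Filter.Eventually.of_forall h0) hi.integrableOn] at h2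
  rw [Filter.EventuallyEq, ae_restrict_iff' hU.compl] at h2
  exact h2

lemma lemP (x y : ℝ → ℝ) (hxm : Measurable x) (hx0 : ∀ p, 0 ≤ x p)
    (hxi : Integrable x mu0) (hm : Measurable y) (h0 : ∀ p, 0 ≤ y p) (hi : Integrable y mu0)
    (H : ∀ l, 0 ≤ l → FF mu0 x l ≤ FF mu0 y l) (hE : ∫ p, x p ∂mu0 = ∫ p, y p ∂mu0) :
    ∃ A B : ℕ → Set ℝ, (∀ n, MeasurableSet (A n)) ∧ (∀ n, MeasurableSet (B n)) ∧
      Pairwise (Function.onFun Disjoint A) ∧ Pairwise (Function.onFun Disjoint B) ∧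
      (∀ n, mu0 (A n) < ⊤) ∧ (∀ n, mu0 (B n) < ⊤) ∧
      (∀ n l, 0 ≤ l → FF mu0 ((B n).indicator x) l ≤ FF mu0 ((A n).indicator y) l) ∧
      (∀ n, ∫ p in B n, x p ∂mu0 = ∫ p in A n, y p ∂mu0) ∧
      (∀ n, B n ⊆ {p | 0 < x p}) ∧
      (∀ p, p ∉ (⋃ n, B n) → x p = 0) ∧
      (∀ᵐ p ∂mu0, p ∉ (⋃ n, A n) → y p = 0) := by
  set V : ℕ → Set ℝ := fun n => {p | 1 < (n : ℝ) * x p} with hV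
  have hVm : ∀ n, MeasurableSet (V n) := fun n =>
    measurableSet_lt measurable_const (hxm.const_mul _)
  have hVmono : Monotone V := by
    intro m n hmn p hp
    have hp : 1 < (m : ℝ) * x p := hp
    show 1 < (n : ℝ) * x p
    have : (m : ℝ) ≤ n := by exact_mod_cast hmn
    nlinarith [hx0 p]
  let Inv : ℕ → Set ℝ → Prop := fun n U => MeasurableSet U ∧
    ∀ l, 0 ≤ l → FF mu0 ((V n)ᶜ.indicator x) l ≤ FF mu0 (Uᶜ.indicator y) l
  have key : ∀ n (U : {U // Inv n U}), ∃ A, MeasurableSet A ∧ A ⊆ (U : Set ℝ)ᶜ ∧ mu0 A < ⊤ ∧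
      (∀ l, 0 ≤ l → FF mu0 ((V (n + 1) \ V n).indicator x) l ≤ FF mu0 (A.indicator y) l) ∧
      (∀ l, 0 ≤ l → FF mu0 ((V (n + 1))ᶜ.indicator x) l ≤
        FF mu0 (((U : Set ℝ) ∪ A)ᶜ.indicator y) l) ∧
      ∫ p in V (n + 1) \ V n, x p ∂mu0 = ∫ p in A, y p ∂mu0 := by
    intro n U
    exact lemP_step x y hxm hx0 hxi hm h0 hi n U U.2.1 U.2.2
  choose G g1 g2 g3 g4 g5 g6 using key
  have hinit : Inv 0 ∅ := by
    refine ⟨MeasurableSet.empty, ?_⟩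
    have : V 0 = ∅ := by ext p; simp [hV]
    rw [this]
    simpa using H
  let u : (n : ℕ) → {U // Inv n U} := fun n => Nat.rec ⟨∅, hinit⟩
    (fun n U => ⟨(U : Set ℝ) ∪ G n U, U.2.1.union (g1 n U), g5 n U⟩) n
  have hu : ∀ n, (u (n + 1)).1 = (u n).1 ∪ G n (u n) :=
    fun n => rfl
  have humono : Monotone fun n => (u n).1 := by
    apply monotone_nat_of_le_succ
    intro n
    rw [hu]
    exact Set.subset_union_left
  have hdA : Pairwise (Function.onFun Disjoint fun n => G n (u n)) := by
    intro m n hmn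
    wlog hlt : m < n generalizing m n
    · exact (this hmn.symm (by omega)).symm
    show Disjoint (G m (u m)) (G n (u n))
    rw [Set.disjoint_left]
    intro p hp hp'
    apply g2 n (u n) hp'
    apply humono (Nat.succ_le_of_lt hlt)
    show p ∈ (u (m + 1)).1
    rw [hu]
    exact Or.inr hp
  have hdB : Pairwise (Function.onFun Disjoint fun n => V (n + 1) \ V n) := by
    intro m n hmn
    wlog hlt : m < n generalizing m n
    · exact (this hmn.symm (by omega)).symm
    show Disjoint (V (m + 1) \ V m) (V (n + 1) \ V n)
    rw [Set.disjoint_left]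
    intro p hp hp'
    exact hp'.2 (hVmono (Nat.succ_le_of_lt hlt) hp.1)
  have hcov : ∀ p, p ∉ (⋃ n, V (n + 1) \ V n) → x p = 0 := by
    intro p hp
    by_contra hc
    have hpos : 0 < x p := lt_of_le_of_ne (hx0 p) (Ne.symm hc)
    have hex : ∃ n, p ∈ V n := by
      obtain ⟨n, hn⟩ := exists_nat_gt (1 / x p)
      refine ⟨n, ?_⟩
      show 1 < (n : ℝ) * x p
      rwa [div_lt_iff₀ hpos] at hn
    classical
    have h1 := Nat.find_spec hex
    have h2 : Nat.find hex ≠ 0 := by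
      intro h
      rw [h] at h1
      have h1 : 1 < ((0 : ℕ) : ℝ) * x p := h1
      simp at h1
      linarith
    obtain ⟨k, hk⟩ := Nat.exists_eq_succ_of_ne_zero h2
    apply hp
    rw [Set.mem_iUnion]
    refine ⟨k, ?_, ?_⟩
    · rw [hk] at h1; exact h1
    · exact Nat.find_min hex (by omega)
  refine ⟨fun n => G n (u n), fun n => V (n + 1) \ V n, fun n => g1 n _,
    fun n => (hVm _).diff (hVm _), hdA, hdB, fun n => g3 n _, ?_, fun n l hl => g4 n _ l hl,
    fun n => g6 n _, ?_, hcov, ?_⟩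
  · intro n
    have hk : (0:ℝ) < 1 / ((n:ℝ) + 1) := by positivity
    refine lt_of_le_of_lt (measure_mono ?_) (meas_gt_lt_top hxi hk)
    intro p hp
    have hp : 1 < ((n + 1 : ℕ) : ℝ) * x p := hp.1
    show 1 / ((n:ℝ) + 1) < x p
    rw [div_lt_iff₀ (by positivity)]
    push_cast at hp
    linarith
  · intro n p hp
    have hp : 1 < ((n + 1 : ℕ) : ℝ) * x p := hp.1
    show 0 < x p
    by_contra hc
    have : x p = 0 := le_antisymm (not_lt.1 hc) (hx0 p)
    rw [this] at hp
    simp at hp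
    linarith
  · apply ae_zero_off h0 hi (MeasurableSet.iUnion fun n => g1 n _)
    rw [integral_iUnion (fun n => g1 n _) hdA hi.integrableOn, ← hE]
    have : ∫ p in ⋃ n, V (n + 1) \ V n, x p ∂mu0 = ∫ p, x p ∂mu0 :=
      setIntegral_eq_integral_of_forall_compl_eq_zero hcov
    rw [← this, integral_iUnion (fun n => (hVm _).diff (hVm _)) hdB hxi.integrableOn]
    congr 1; ext n
    exact (g6 n _).symm
lemma lemQ (x y : ℝ → ℝ) (hxm : Measurable x) (hx0 : ∀ p, 0 ≤ x p)
    (hxi : Integrable x mu0) (hm : Measurable y) (h0 : ∀ p, 0 ≤ y p) (hi : Integrable y mu0)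
    (H : ∀ l, 0 ≤ l → FF mu0 x l ≤ FF mu0 y l) :
    ∃ A B : ℕ → Set ℝ, ∃ R : Set ℝ, (∀ n, MeasurableSet (A n)) ∧ (∀ n, MeasurableSet (B n)) ∧
      MeasurableSet R ∧
      Pairwise (Function.onFun Disjoint A) ∧ Pairwise (Function.onFun Disjoint B) ∧
      (∀ n, Disjoint (A n) R) ∧
      (∀ n, mu0 (A n) < ⊤) ∧ (∀ n, mu0 (B n) < ⊤) ∧
      (∀ n l, 0 ≤ l → FF mu0 ((B n).indicator x) l ≤ FF mu0 ((A n).indicator y) l) ∧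
      (∀ n, ∫ p in B n, x p ∂mu0 = ∫ p in A n, y p ∂mu0) ∧
      (∀ n, A n ⊆ {p | 0 < y p}) ∧ (∀ n, B n ⊆ {p | 0 < x p}) ∧ R ⊆ {p | 0 < y p} ∧
      (∀ p, p ∉ (⋃ n, B n) → x p = 0) ∧
      (∀ᵐ p ∂mu0, p ∉ (⋃ n, A n) → p ∉ R → y p = 0) ∧
      ∫ p in R, y p ∂mu0 = ∫ p, y p ∂mu0 - ∫ p, x p ∂mu0 := by
  obtain ⟨C, hC, hC1, hC2⟩ := trunc x y hxi hx0 hm h0 hi H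
  have hP : MeasurableSet {p | 0 < y p} := measurableSet_lt measurable_const hm
  obtain ⟨A, B, a1, a2, a3, a4, a5, a6, a7, a8, a9, a10, a11⟩ :=
    lemP x (C.indicator y) hxm hx0 hxi (hm.indicator hC)
      (fun p => Set.indicator_nonneg (fun p _ => h0 p) p) (hi.indicator hC) hC1
      (by rw [integral_indicator hC]; exact hC2)
  have hA' : ∀ n, MeasurableSet (A n ∩ (C ∩ {p | 0 < y p})) :=
    fun n => (a1 n).inter (hC.inter hP)
  have hind : ∀ n, (A n).indicator (C.indicator y) =
      (A n ∩ (C ∩ {p | 0 < y p})).indicator y := by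
    intro n
    ext p
    rw [Set.indicator_indicator]
    by_cases h1 : p ∈ A n ∩ (C ∩ {p | 0 < y p})
    · rw [Set.indicator_of_mem h1, Set.indicator_of_mem (show p ∈ A n ∩ C from ⟨h1.1, h1.2.1⟩)]
    · rw [Set.indicator_of_notMem h1]
      by_cases h2 : p ∈ A n ∩ C
      · rw [Set.indicator_of_mem h2]
        by_contra hc
        exact h1 ⟨h2.1, h2.2, lt_of_le_of_ne (h0 p) (Ne.symm hc)⟩
      · rw [Set.indicator_of_notMem h2]
  refine ⟨fun n => A n ∩ (C ∩ {p | 0 < y p}), B, {p | 0 < y p} \ C, hA', a2, hP.diff hC, ?_, a4, ?_,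
    ?_, a6, ?_, ?_, ?_, a9, ?_, a10, ?_, ?_⟩
  · intro m n hmn
    exact (a3 hmn).mono Set.inter_subset_left Set.inter_subset_left
  · intro n
    rw [Set.disjoint_left]
    intro p hp hp'
    exact hp'.2 hp.2.1
  · intro n
    exact lt_of_le_of_lt (measure_mono Set.inter_subset_left) (a5 n)
  · intro n l hl
    have := a7 n l hl
    rwa [hind] at this
  · intro n
    rw [a8, ← integral_indicator (a1 n), hind, integral_indicator (hA' n)]
  · intro n p hp
    exact hp.2.2
  · intro p hp
    exact hp.1
  · filter_upwards [a11] with p hp h1 h2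
    by_contra hc
    have hpos : 0 < y p := lt_of_le_of_ne (h0 p) (Ne.symm hc)
    have hpC : p ∈ C := by
      by_contra h
      exact h2 ⟨hpos, h⟩
    have : p ∉ ⋃ n, A n := by
      intro h
      obtain ⟨n, hn⟩ := Set.mem_iUnion.1 h
      exact h1 (Set.mem_iUnion.2 ⟨n, hn, hpC, hpos⟩)
    have := hp this
    rw [Set.indicator_of_mem hpC] at this
    exact hc this
  · have h1 := integral_add_compl hC hi
    have h2 : ∫ p in {p | 0 < y p} \ C, y p ∂mu0 = ∫ p in Cᶜ, y p ∂mu0 := by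
      rw [← integral_indicator (hP.diff hC), ← integral_indicator hC.compl]
      congr 1
      ext p
      by_cases hp : p ∈ C
      · have q1 : p ∉ {p | 0 < y p} \ C := fun h => h.2 hp
        have q2 : p ∉ Cᶜ := fun h => h hp
        rw [Set.indicator_of_notMem q1, Set.indicator_of_notMem q2]
      · rw [Set.indicator_of_mem (show p ∈ Cᶜ from hp)]
        by_cases h : 0 < y p
        · rw [Set.indicator_of_mem (show p ∈ {p | 0 < y p} \ C from ⟨h, hp⟩)]
        · have q1 : p ∉ {p | 0 < y p} \ C := fun h' => h h'.1
          rw [Set.indicator_of_notMem q1]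
          linarith [h0 p]
    rw [h2, hC2]
    linarith

lemma cuts (ρ : Measure ℝ) [NullSingletonClass ρ] (hfin : ∀ r, ρ (Set.Iio r) < ⊤)
    (h0 : ρ (Set.Iio 0) = 0) (s : ℕ → ENNReal) (hs : StrictMono s) (hs0 : s 0 = 0)
    (hlt : ∀ n, s n < ρ Set.univ) :
    ∃ r : ℕ → ℝ, r 0 = 0 ∧ Monotone r ∧ (∀ n, ρ (Set.Iio (r n)) = s n) ∧
      ∀ n, ρ (Set.Ico (r n) (r (n + 1))) = s (n + 1) - s n := by
  have : ∀ n, ∃ r : ℝ, (n = 0 → r = 0) ∧ ρ (Set.Iio r) = s n := by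
    intro n
    rcases Nat.eq_zero_or_pos n with rfl | hn
    · exact ⟨0, fun _ => rfl, by rw [h0, hs0]⟩
    · obtain ⟨r, -, hr⟩ := pos_cut ρ hfin h0 (s n) (hlt n)
      exact ⟨r, fun h => by omega, hr⟩
  choose r r1 r2 using this
  have hmono : Monotone r := by
    apply monotone_nat_of_le_succ
    intro n
    by_contra hc
    push Not at hc
    have h1 : ρ (Set.Iio (r (n + 1))) ≤ ρ (Set.Iio (r n)) :=
      measure_mono (Set.Iio_subset_Iio hc.le)
    rw [r2, r2] at h1
    exact absurd (hs (Nat.lt_succ_self n)) (not_lt.2 h1)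
  refine ⟨r, r1 0 rfl, hmono, r2, fun n => ?_⟩
  have : Set.Ico (r n) (r (n + 1)) = Set.Iio (r (n + 1)) \ Set.Iio (r n) := by
    ext p; simp
  rw [this, measure_sdiff (Set.Iio_subset_Iio (hmono (Nat.le_succ n)))
    measurableSet_Iio.nullMeasurableSet (hfin _).ne, r2, r2]

lemma Ico_disj {r : ℕ → ℝ} (hr : Monotone r) :
    Pairwise (Function.onFun Disjoint fun n => Set.Ico (r n) (r (n + 1))) := by
  intro m n hmn
  wlog hlt : m < n generalizing m n
  · exact (this hmn.symm (by omega)).symm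
  show Disjoint (Set.Ico (r m) (r (m + 1))) (Set.Ico (r n) (r (n + 1)))
  rw [Set.disjoint_left]
  intro p hp hp'
  have := hr (Nat.succ_le_of_lt hlt)
  exact absurd (hp.2.trans_le (this.trans hp'.1)) (lt_irrefl _)

lemma lemR (y : ℝ → ℝ) (hm : Measurable y) (h0 : ∀ p, 0 ≤ y p) (hi : Integrable y mu0)
    (R : Set ℝ) (hR : MeasurableSet R) :
    ∃ D : ℕ → Set ℝ, (∀ n, MeasurableSet (D n)) ∧ Pairwise (Function.onFun Disjoint D) ∧
      (∀ n, D n ⊆ R) ∧ (∀ n, mu0 (D n) < ⊤) ∧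
      (∀ n, ∫ p in D n, y p ∂mu0 = (1 / 2) / 2 ^ n * ∫ p in R, y p ∂mu0) ∧
      (∀ᵐ p ∂mu0, p ∈ R → p ∉ (⋃ n, D n) → y p = 0) := by
  have hfinish : ∀ D : ℕ → Set ℝ, (∀ n, MeasurableSet (D n)) → Pairwise (Function.onFun Disjoint D) →
      (∀ n, D n ⊆ R) →
      (∀ n, ∫ p in D n, y p ∂mu0 = (1 / 2) / 2 ^ n * ∫ p in R, y p ∂mu0) →
      (∀ᵐ p ∂mu0, p ∈ R → p ∉ (⋃ n, D n) → y p = 0) := by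
    intro D d1 d2 d3 d4
    have hU := MeasurableSet.iUnion d1
    have := ae_zero_off (y := R.indicator y) (fun p => Set.indicator_nonneg (fun p _ => h0 p) p)
      (hi.indicator hR) hU ?_
    · filter_upwards [this] with p hp h1 h2
      have := hp h2
      rwa [Set.indicator_of_mem h1] at this
    · rw [setIntegral_indicator hR, integral_indicator hR,
        Set.inter_eq_left.2 (Set.iUnion_subset d3), integral_iUnion d1 d2 hi.integrableOn]
      simp_rw [d4]
      rw [tsum_mul_right, tsum_geometric_two' 1, one_mul]
  set δ := ∫ p in R, y p ∂mu0 with hδ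
  have hδ0 : 0 ≤ δ := integral_nonneg h0
  rcases eq_or_lt_of_le hδ0 with e | e
  · refine ⟨fun _ => ∅, ?_, ?_, ?_, ?_, ?_, hfinish (fun _ => ∅) (by simp) ?_ (by simp)
      (by simp [← e])⟩
    · simp
    · intro m n _; simp [Function.onFun]
    · simp
    · simp
    · simp [← e]
    · intro m n _; simp [Function.onFun]
  set ρ := (mu0.restrict R).withDensity fun p => ENNReal.ofReal (y p) with hρ
  have hρa : ∀ S, MeasurableSet S → ρ S = ENNReal.ofReal (∫ p in S ∩ R, y p ∂mu0) := by
    intro S hS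
    rw [hρ, withDensity_apply _ hS, Measure.restrict_restrict hS,
      ofReal_integral_eq_lintegral_ofReal hi.integrableOn (Filter.Eventually.of_forall h0)]
  have hac : ρ ≪ mu0 := (withDensity_absolutelyContinuous _ _).trans
    Measure.absolutelyContinuous_restrict
  have : NullSingletonClass ρ := ⟨fun a => hac (measure_singleton a)⟩
  have hfin : ∀ r, ρ (Set.Iio r) < ⊤ := fun r => by
    rw [hρa _ measurableSet_Iio]; exact ENNReal.ofReal_lt_top
  have hz : ρ (Set.Iio 0) = 0 := by
    apply hac
    rw [Measure.restrict_apply measurableSet_Iio]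
    have : Set.Iio (0:ℝ) ∩ Set.Ioi 0 = ∅ := by
      ext p; simp; intro h; exact h.le
    rw [this]; simp
  have hs : StrictMono fun n : ℕ => ENNReal.ofReal ((1 - 1 / 2 ^ n) * δ) := by
    apply strictMono_nat_of_lt_succ
    intro n
    have h2 : (0:ℝ) < 1 / 2 ^ n := by positivity
    have h3 : (1:ℝ) / 2 ^ (n + 1) = 1 / 2 ^ n / 2 := by rw [pow_succ]; field_simp
    have h4 : (1:ℝ) / 2 ^ n ≤ 1 := by
      rw [div_le_one (by positivity)]; exact one_le_pow₀ (by norm_num)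
    rw [ENNReal.ofReal_lt_ofReal_iff]
    · rw [h3]; nlinarith
    · rw [h3]; apply mul_pos _ e; linarith
  obtain ⟨r, r0, rm, -, hr⟩ := cuts ρ hfin hz _ hs (by simp) (by
    intro n
    have h2 : (0:ℝ) < 1 / 2 ^ n := by positivity
    rw [hρa _ MeasurableSet.univ, Set.univ_inter, ← hδ, ENNReal.ofReal_lt_ofReal_iff e]
    nlinarith)
  have d1 : ∀ n, MeasurableSet (Set.Ico (r n) (r (n + 1)) ∩ R) :=
    fun n => measurableSet_Ico.inter hR
  have d2 : Pairwise (Function.onFun Disjoint fun n => Set.Ico (r n) (r (n + 1)) ∩ R) := by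
    intro m n hmn
    exact (Ico_disj rm hmn).mono Set.inter_subset_left Set.inter_subset_left
  have d3 : ∀ n, Set.Ico (r n) (r (n + 1)) ∩ R ⊆ R := fun n => Set.inter_subset_right
  have d4 : ∀ n, ∫ p in Set.Ico (r n) (r (n + 1)) ∩ R, y p ∂mu0 = (1 / 2) / 2 ^ n * δ := by
    intro n
    have h1 := hr n
    have h2 : (0:ℝ) < 1 / 2 ^ n := by positivity
    have h3 : (1:ℝ) / 2 ^ (n + 1) = 1 / 2 ^ n / 2 := by rw [pow_succ]; field_simp
    have h4 : (1:ℝ) / 2 ^ n ≤ 1 := by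
      rw [div_le_one (by positivity)]; exact one_le_pow₀ (by norm_num)
    rw [hρa _ measurableSet_Ico, ← ENNReal.ofReal_sub _ (mul_nonneg (by linarith) hδ0),
      ENNReal.ofReal_eq_ofReal_iff (integral_nonneg h0)] at h1
    · rw [h1, h3]; ring
    · rw [h3]; nlinarith
  refine ⟨_, d1, d2, d3, fun n => ?_, d4, hfinish _ d1 d2 d3 d4⟩
  refine lt_of_le_of_lt (measure_mono Set.inter_subset_left) ?_
  refine lt_of_le_of_lt (Measure.restrict_apply_le _ _) ?_
  simp
lemma ind_drop {f : ℝ → ℝ} {S S' : Set ℝ} (h : ∀ p ∈ S', f p = 0) :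
    (S ∪ S').indicator f = S.indicator f := by
  ext p
  by_cases h1 : p ∈ S
  · rw [Set.indicator_of_mem h1, Set.indicator_of_mem (Set.mem_union_left S' h1)]
  · rw [Set.indicator_of_notMem h1]
    by_cases h2 : p ∈ S'
    · rw [Set.indicator_of_mem (Set.mem_union_right S h2), h p h2]
    · rw [Set.indicator_of_notMem]
      rintro (h | h)
      · exact h1 h
      · exact h2 h

lemma lemQR (x y : ℝ → ℝ) (hxm : Measurable x) (hx0 : ∀ p, 0 ≤ x p)
    (hxi : Integrable x mu0) (hm : Measurable y) (h0 : ∀ p, 0 ≤ y p) (hi : Integrable y mu0)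
    (H : ∀ l, 0 ≤ l → FF mu0 x l ≤ FF mu0 y l) :
    ∃ A B : ℕ → Set ℝ, (∀ n, MeasurableSet (A n)) ∧ (∀ n, MeasurableSet (B n)) ∧
      Pairwise (Function.onFun Disjoint A) ∧ Pairwise (Function.onFun Disjoint B) ∧
      (∀ n, mu0 (A n) < ⊤) ∧ (∀ n, mu0 (B n) < ⊤) ∧
      (∀ n l, 0 ≤ l → FF mu0 ((B n).indicator x) l ≤ FF mu0 ((A n).indicator y) l) ∧
      (∀ n, ∫ p in A n, y p ∂mu0 = ∫ p in B n, x p ∂mu0 +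
        (1 / 2) / 2 ^ n * (∫ p, y p ∂mu0 - ∫ p, x p ∂mu0)) ∧
      (∀ n, A n ⊆ {p | 0 < y p}) ∧ (∀ n, B n ⊆ {p | 0 < x p}) ∧
      (∀ p, p ∉ (⋃ n, B n) → x p = 0) ∧
      (∀ᵐ p ∂mu0, p ∉ (⋃ n, A n) → y p = 0) := by
  obtain ⟨A, B, R, a1, a2, a3, a4, a5, a6, a7, a8, a9, a10, a11, a12, a13, a14, a15, a16⟩ :=
    lemQ x y hxm hx0 hxi hm h0 hi H
  obtain ⟨D, d1, d2, d3, d4, d5, d6⟩ := lemR y hm h0 hi R a3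
  refine ⟨fun n => A n ∪ D n, B, fun n => (a1 n).union (d1 n), a2, ?_, a5,
    fun n => lt_of_le_of_lt (measure_union_le _ _) (ENNReal.add_lt_top.2 ⟨a7 n, d4 n⟩), a8, ?_, ?_,
    fun n => Set.union_subset (a11 n) ((d3 n).trans a13), a12, a14, ?_⟩
  · intro m n hmn
    show Disjoint (A m ∪ D m) (A n ∪ D n)
    rw [Set.disjoint_union_left, Set.disjoint_union_right, Set.disjoint_union_right]
    exact ⟨⟨a4 hmn, (a6 m).mono_right (d3 n)⟩, ((a6 n).mono_right (d3 m)).symm, d2 hmn⟩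
  · intro n l hl
    exact (a9 n l hl).trans (FF_ind_mono hi (a1 n) ((a1 n).union (d1 n)) Set.subset_union_left hl)
  · intro n
    rw [setIntegral_union ((a6 n).mono_right (d3 n)) (d1 n) hi.integrableOn hi.integrableOn,
      a10, d5, a16]
  · filter_upwards [a15, d6] with p h1 h2 h3
    by_cases hp : p ∈ R
    · apply h2 hp
      intro h
      obtain ⟨n, hn⟩ := Set.mem_iUnion.1 h
      exact h3 (Set.mem_iUnion.2 ⟨n, Or.inr hn⟩)
    · refine h1 ?_ hp
      intro h
      obtain ⟨n, hn⟩ := Set.mem_iUnion.1 h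
      exact h3 (Set.mem_iUnion.2 ⟨n, Or.inl hn⟩)

lemma int_parts {x : ℝ → ℝ} {ν : Measure ℝ} (h : Integrable x ν) :
    ∫ p, x p ∂ν = ∫ p, posPart' x p ∂ν - ∫ p, negPart' x p ∂ν := by
  rw [← integral_sub]
  · congr 1; ext p
    unfold posPart' negPart'
    rcases le_total 0 (x p) with h | h
    · rw [max_eq_left h, max_eq_right (by linarith)]; ring
    · rw [max_eq_right h, max_eq_left (by linarith)]; ring
  · exact h.pos_part
  · exact h.neg_part

lemma pos_of_neg {x : ℝ → ℝ} {p : ℝ} (h : 0 < negPart' x p) : posPart' x p = 0 := by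
  unfold posPart' negPart' at *
  rcases lt_max_iff.1 h with h | h
  · exact max_eq_right (by linarith)
  · exact absurd h (lt_irrefl _)

lemma neg_of_pos {x : ℝ → ℝ} {p : ℝ} (h : 0 < posPart' x p) : negPart' x p = 0 := by
  unfold posPart' negPart' at *
  rcases lt_max_iff.1 h with h | h
  · exact max_eq_right (by linarith)
  · exact absurd h (lt_irrefl _)

lemma parts_zero {x : ℝ → ℝ} {p : ℝ} (h : posPart' x p = 0) (h' : negPart' x p = 0) : x p = 0 := by
  unfold posPart' negPart' at *
  have h1 := max_eq_right_iff.1 h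
  have h2 := max_eq_right_iff.1 h'
  linarith

lemma parts_disj {y : ℝ → ℝ} {A A' : ℕ → Set ℝ} (hA : ∀ n, A n ⊆ {p | 0 < posPart' y p})
    (hA' : ∀ n, A' n ⊆ {p | 0 < negPart' y p}) (h : Pairwise (Function.onFun Disjoint A))
    (h' : Pairwise (Function.onFun Disjoint A')) :
    Pairwise (Function.onFun Disjoint fun n => A n ∪ A' n) := by
  have key : ∀ m n, Disjoint (A m) (A' n) := by
    intro m n
    rw [Set.disjoint_left]
    intro p hp hp'
    have h1 : 0 < posPart' y p := hA m hp
    have := pos_of_neg (hA' n hp')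
    linarith
  intro m n hmn
  show Disjoint (A m ∪ A' m) (A n ∪ A' n)
  rw [Set.disjoint_union_left, Set.disjoint_union_right, Set.disjoint_union_right]
  exact ⟨⟨h hmn, key _ _⟩, (key _ _).symm, h' hmn⟩

lemma lemS (x y : ℝ → ℝ) (hxm : Measurable x) (hxi : Integrable x mu0) (hm : Measurable y)
    (hi : Integrable y mu0)
    (H : ∀ l, 0 ≤ l → FF mu0 (posPart' x) l ≤ FF mu0 (posPart' y) l)
    (H' : ∀ l, 0 ≤ l → FF mu0 (negPart' x) l ≤ FF mu0 (negPart' y) l)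
    (hE : ∫ p, x p ∂mu0 = ∫ p, y p ∂mu0) :
    ∃ A B : ℕ → Set ℝ, (∀ n, MeasurableSet (A n)) ∧ (∀ n, MeasurableSet (B n)) ∧
      Pairwise (Function.onFun Disjoint A) ∧ Pairwise (Function.onFun Disjoint B) ∧
      (∀ n, mu0 (A n) < ⊤) ∧ (∀ n, mu0 (B n) < ⊤) ∧
      (∀ n l, 0 ≤ l → FF mu0 ((B n).indicator (posPart' x)) l ≤
        FF mu0 ((A n).indicator (posPart' y)) l) ∧
      (∀ n l, 0 ≤ l → FF mu0 ((B n).indicator (negPart' x)) l ≤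
        FF mu0 ((A n).indicator (negPart' y)) l) ∧
      (∀ n, ∫ p in B n, x p ∂mu0 = ∫ p in A n, y p ∂mu0) ∧
      (∀ᵐ p ∂mu0, p ∉ (⋃ n, B n) → x p = 0) ∧
      (∀ᵐ p ∂mu0, p ∉ (⋃ n, A n) → y p = 0) := by
  have hp0 : ∀ (z : ℝ → ℝ) p, 0 ≤ posPart' z p := fun z p => le_max_right _ _
  have hn0 : ∀ (z : ℝ → ℝ) p, 0 ≤ negPart' z p := fun z p => le_max_right _ _
  have ixp : Integrable (posPart' x) mu0 := hxi.pos_part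
  have ixn : Integrable (negPart' x) mu0 := hxi.neg_part
  have iyp : Integrable (posPart' y) mu0 := hi.pos_part
  have iyn : Integrable (negPart' y) mu0 := hi.neg_part
  obtain ⟨A, B, a1, a2, a3, a4, a5, a6, a7, a8, a9, a10, a11, a12⟩ :=
    lemQR (posPart' x) (posPart' y) (hxm.max measurable_const) (hp0 _) ixp
      (hm.max measurable_const) (hp0 _) iyp H
  obtain ⟨A', B', b1, b2, b3, b4, b5, b6, b7, b8, b9, b10, b11, b12⟩ :=
    lemQR (negPart' x) (negPart' y) (hxm.neg.max measurable_const) (hn0 _) ixn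
      (hm.neg.max measurable_const) (hn0 _) iyn H'
  have eBp : ∀ n, (B n ∪ B' n).indicator (posPart' x) = (B n).indicator (posPart' x) :=
    fun n => ind_drop fun p hp => pos_of_neg (b10 n hp)
  have eBn : ∀ n, (B n ∪ B' n).indicator (negPart' x) = (B' n).indicator (negPart' x) :=
    fun n => by
      rw [Set.union_comm]; exact ind_drop fun p hp => neg_of_pos (a10 n hp)
  have eAp : ∀ n, (A n ∪ A' n).indicator (posPart' y) = (A n).indicator (posPart' y) :=
    fun n => ind_drop fun p hp => pos_of_neg (b9 n hp)
  have eAn : ∀ n, (A n ∪ A' n).indicator (negPart' y) = (A' n).indicator (negPart' y) :=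
    fun n => by
      rw [Set.union_comm]; exact ind_drop fun p hp => neg_of_pos (a9 n hp)
  have hAm := fun n => (a1 n).union (b1 n)
  have hBm := fun n => (a2 n).union (b2 n)
  refine ⟨fun n => A n ∪ A' n, fun n => B n ∪ B' n, hAm, hBm, parts_disj a9 b9 a3 b3,
    parts_disj a10 b10 a4 b4,
    fun n => lt_of_le_of_lt (measure_union_le _ _) (ENNReal.add_lt_top.2 ⟨a5 n, b5 n⟩),
    fun n => lt_of_le_of_lt (measure_union_le _ _) (ENNReal.add_lt_top.2 ⟨a6 n, b6 n⟩),
    ?_, ?_, ?_, ?_, ?_⟩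
  · intro n l hl
    rw [eBp, eAp]; exact a7 n l hl
  · intro n l hl
    rw [eBn, eAn]; exact b7 n l hl
  · intro n
    rw [int_parts hxi, int_parts hi] at hE
    rw [int_parts hxi.integrableOn, int_parts hi.integrableOn,
      ← integral_indicator (hBm n), ← integral_indicator (hBm n),
      ← integral_indicator (hAm n), ← integral_indicator (hAm n), eBp, eBn, eAp, eAn,
      integral_indicator (a1 n), integral_indicator (a2 n), integral_indicator (b1 n),
      integral_indicator (b2 n), a8, b8]
    have : (∫ p, posPart' y p ∂mu0 - ∫ p, posPart' x p ∂mu0) =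
      (∫ p, negPart' y p ∂mu0 - ∫ p, negPart' x p ∂mu0) := by linarith
    rw [this]; ring
  · refine Filter.Eventually.of_forall fun p hp => ?_
    rw [Set.mem_iUnion] at hp
    push Not at hp
    refine parts_zero (a11 p ?_) (b11 p ?_)
    · rw [Set.mem_iUnion]; rintro ⟨n, hn⟩; exact hp n (Or.inl hn)
    · rw [Set.mem_iUnion]; rintro ⟨n, hn⟩; exact hp n (Or.inr hn)
  · filter_upwards [a12, b12] with p h1 h2 hp
    rw [Set.mem_iUnion] at hp
    push Not at hp
    refine parts_zero (h1 ?_) (h2 ?_)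
    · rw [Set.mem_iUnion]; rintro ⟨n, hn⟩; exact hp n (Or.inl hn)
    · rw [Set.mem_iUnion]; rintro ⟨n, hn⟩; exact hp n (Or.inr hn)
/-- extension by zero to the second copy -/
def lft (g : ℝ → ℝ) : ℝ × Fin 2 → ℝ := fun p => if p.2 = 0 then g p.1 else 0

lemma nuSum_eq : νSum = Measure.map (fun t : ℝ => (t, (0 : Fin 2))) mu0 +
    Measure.map (fun t : ℝ => (t, (1 : Fin 2))) mu0 := by
  have : (Measure.count : Measure (Fin 2)) = Measure.dirac 0 + Measure.dirac 1 := by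
    ext s hs
    simp [Measure.count, Measure.sum_apply _ hs, tsum_fintype, Fin.sum_univ_two]
  unfold νSum
  rw [this, Measure.prod_add, Measure.prod_dirac, Measure.prod_dirac]

lemma nu_apply {S : Set (ℝ × Fin 2)} (hS : MeasurableSet S) :
    νSum S = mu0 {t | (t, (0 : Fin 2)) ∈ S} + mu0 {t | (t, (1 : Fin 2)) ∈ S} := by
  rw [nuSum_eq, Measure.add_apply, Measure.map_apply (by fun_prop) hS,
    Measure.map_apply (by fun_prop) hS]
  rfl

lemma emb (i : Fin 2) : MeasurableEmbedding (fun t : ℝ => (t, i)) :=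
  measurableEmbedding_prod_mk_right i

lemma nu_ae {P : ℝ × Fin 2 → Prop} (h0 : ∀ᵐ t ∂mu0, P (t, 0)) (h1 : ∀ t, P (t, 1)) :
    ∀ᵐ p ∂νSum, P p := by
  rw [nuSum_eq, ae_add_measure_iff, (emb 0).ae_map_iff, (emb 1).ae_map_iff]
  exact ⟨h0, Filter.Eventually.of_forall h1⟩

lemma lft_int {g : ℝ → ℝ} (hg : Integrable g mu0) : Integrable (lft g) νSum := by
  rw [nuSum_eq, integrable_add_measure, (emb 0).integrable_map_iff, (emb 1).integrable_map_iff]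
  constructor
  · exact hg
  · have : lft g ∘ (fun t : ℝ => (t, (1 : Fin 2))) = fun _ => 0 := by
      ext t; simp [lft]
    rw [this]; simp

lemma lft_integral {g : ℝ → ℝ} (hg : Integrable g mu0) : ∫ p, lft g p ∂νSum = ∫ t, g t ∂mu0 := by
  have h := lft_int hg
  rw [nuSum_eq, integrable_add_measure] at h
  rw [nuSum_eq, integral_add_measure h.1 h.2, (emb 0).integral_map, (emb 1).integral_map]
  simp [lft]

lemma lft_FF {g : ℝ → ℝ} (hg : Integrable g mu0) {l : ℝ} (hl : 0 ≤ l) :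
    FF νSum (lft g) l = FF mu0 g l := by
  unfold FF
  rw [← lft_integral (FF_integrable hg hl)]
  congr 1; ext p
  unfold lft
  split_ifs <;> simp [hl]

lemma lemM {f g : ℝ × Fin 2 → ℝ} {u v : ℝ → ℝ} (hf : f =ᵐ[νSum] lft u) (hg : g =ᵐ[νSum] lft v)
    (hu : Integrable u mu0) (hv : Integrable v mu0)
    (H : ∀ l, 0 ≤ l → FF mu0 (posPart' u) l ≤ FF mu0 (posPart' v) l)
    (H' : ∀ l, 0 ≤ l → FF mu0 (negPart' u) l ≤ FF mu0 (negPart' v) l)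
    (hE : ∫ p, u p ∂mu0 = ∫ p, v p ∂mu0) : MajM νSum f g := by
  have ep : ∀ {f : ℝ × Fin 2 → ℝ} {u : ℝ → ℝ}, f =ᵐ[νSum] lft u →
      (fun p => max (f p) 0) =ᵐ[νSum] lft (posPart' u) := by
    intro f u h
    filter_upwards [h] with p hp
    rw [hp]; unfold lft posPart'; split_ifs <;> simp
  have en : ∀ {f : ℝ × Fin 2 → ℝ} {u : ℝ → ℝ}, f =ᵐ[νSum] lft u →
      (fun p => max (-f p) 0) =ᵐ[νSum] lft (negPart' u) := by
    intro f u h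
    filter_upwards [h] with p hp
    rw [hp]; unfold lft negPart'; split_ifs <;> simp
  have iup : Integrable (posPart' u) mu0 := hu.pos_part
  have iun : Integrable (negPart' u) mu0 := hu.neg_part
  have ivp : Integrable (posPart' v) mu0 := hv.pos_part
  have ivn : Integrable (negPart' v) mu0 := hv.neg_part
  refine ⟨?_, ?_, ?_⟩
  · apply sub_of_FF ((lft_int iup).congr (ep hf).symm) (fun _ => le_max_right _ _)
      ((lft_int ivp).congr (ep hg).symm) (fun _ => le_max_right _ _)
    intro l hl
    rw [FF_congr (ep hf), FF_congr (ep hg), lft_FF iup hl, lft_FF ivp hl]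
    exact H l hl
  · apply sub_of_FF ((lft_int iun).congr (en hf).symm) (fun _ => le_max_right _ _)
      ((lft_int ivn).congr (en hg).symm) (fun _ => le_max_right _ _)
    intro l hl
    rw [FF_congr (en hf), FF_congr (en hg), lft_FF iun hl, lft_FF ivn hl]
    exact H' l hl
  · rw [integral_congr_ae hf, integral_congr_ae hg, lft_integral hu, lft_integral hv, hE]

lemma lemPad (Z : Set (ℝ × Fin 2)) (hZ : MeasurableSet Z)
    (hZ0 : Z ⊆ Set.Ioi (0:ℝ) ×ˢ (Set.univ : Set (Fin 2))) (hZt : νSum Z = ⊤) (q : ℕ → ENNReal)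
    (q1 : ∀ n, 1 ≤ q n) (qt : ∀ n, q n < ⊤) :
    ∃ P : ℕ → Set (ℝ × Fin 2), (∀ n, MeasurableSet (P n)) ∧
      Pairwise (Function.onFun Disjoint P) ∧ (⋃ n, P n) = Z ∧ ∀ n, νSum (P n) = q n := by
  set ρ := Measure.map Prod.fst (νSum.restrict Z) with hρ
  have hρa : ∀ S, MeasurableSet S → ρ S = νSum (Prod.fst ⁻¹' S ∩ Z) := by
    intro S hS
    rw [hρ, Measure.map_apply measurable_fst hS, Measure.restrict_apply (measurable_fst hS)]
  have hle : ∀ S, MeasurableSet S → ρ S ≤ mu0 S + mu0 S := by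
    intro S hS
    rw [hρa S hS]
    refine (measure_mono Set.inter_subset_left).trans ?_
    rw [nu_apply (measurable_fst hS)]
    rfl
  have hnul : NullSingletonClass ρ := ⟨fun a => by
    refine le_antisymm ((hle _ (measurableSet_singleton a)).trans ?_) zero_le
    rw [measure_singleton]; simp⟩
  have hfin : ∀ r, ρ (Set.Iio r) < ⊤ := fun r => by
    refine lt_of_le_of_lt (hle _ measurableSet_Iio) ?_
    have : mu0 (Set.Iio r) < ⊤ := by
      rw [Measure.restrict_apply measurableSet_Iio]
      refine lt_of_le_of_lt (measure_mono (t := Set.Ioo 0 r) fun p hp => ⟨hp.2, hp.1⟩) ?_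
      simp
    exact ENNReal.add_lt_top.2 ⟨this, this⟩
  have hz : ρ (Set.Iio 0) = 0 := by
    refine le_antisymm ((hle _ measurableSet_Iio).trans ?_) zero_le
    rw [Measure.restrict_apply measurableSet_Iio]
    have : Set.Iio (0:ℝ) ∩ Set.Ioi 0 = ∅ := by
      ext p; simp; intro h; exact h.le
    rw [this]; simp
  have hst : ∀ n, ∑ i ∈ Finset.range n, q i < ⊤ := fun n => ENNReal.sum_lt_top.2 fun i _ => qt i
  have hs : StrictMono fun n : ℕ => ∑ i ∈ Finset.range n, q i := by
    apply strictMono_nat_of_lt_succ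
    intro n
    rw [Finset.sum_range_succ]
    exact ENNReal.lt_add_right (hst n).ne (by
      intro h
      have := q1 n
      rw [h] at this
      simp at this)
  obtain ⟨r, r0, rm, r1, r2⟩ := cuts ρ hfin hz _ hs (by simp) (by
    intro n
    rw [hρa _ MeasurableSet.univ, Set.preimage_univ, Set.univ_inter, hZt]
    exact hst n)
  have hunb : ∀ M : ℝ, ∃ n, M < r n := by
    intro M
    by_contra hc
    push Not at hc
    obtain ⟨n, hn⟩ := ENNReal.exists_nat_gt (hfin M).ne
    have h1 : ρ (Set.Iio (r n)) ≤ ρ (Set.Iio M) := measure_mono (Set.Iio_subset_Iio (hc n))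
    rw [r1] at h1
    have h2 : (n : ENNReal) ≤ ∑ i ∈ Finset.range n, q i := by
      calc (n : ENNReal) = ∑ i ∈ Finset.range n, 1 := by simp
        _ ≤ _ := Finset.sum_le_sum fun i _ => q1 i
    exact absurd (hn.trans_le (h2.trans h1)) (lt_irrefl _)
  refine ⟨fun n => Prod.fst ⁻¹' (Set.Ico (r n) (r (n + 1))) ∩ Z,
    fun n => (measurable_fst measurableSet_Ico).inter hZ, ?_, ?_, ?_⟩
  · intro m n hmn
    show Disjoint (_ ∩ Z) (_ ∩ Z)
    exact ((Ico_disj rm hmn).preimage Prod.fst).mono Set.inter_subset_left Set.inter_subset_left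
  · ext p
    rw [Set.mem_iUnion]
    constructor
    · rintro ⟨n, hn⟩; exact hn.2
    · intro hp
      have hp0 : 0 < p.1 := (hZ0 hp).1
      classical
      have hex := hunb p.1
      have h1 := Nat.find_spec hex
      have h2 : Nat.find hex ≠ 0 := by
        intro h
        rw [h, r0] at h1
        linarith
      obtain ⟨k, hk⟩ := Nat.exists_eq_succ_of_ne_zero h2
      refine ⟨k, ⟨?_, ?_⟩, hp⟩
      · exact not_lt.1 (Nat.find_min hex (show k < Nat.find hex by omega))
      · rw [hk] at h1; exact h1
  · intro n
    have := r2 n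
    rw [hρa _ measurableSet_Ico] at this
    rw [this, Finset.sum_range_succ]
    exact ENNReal.add_sub_cancel_left (hst n).ne

lemma lemPad2 (A : ℕ → Set ℝ) (hA : ∀ n, MeasurableSet (A n))
    (hd : Pairwise (Function.onFun Disjoint A)) (c : ℕ → ENNReal)
    (hc : ∀ n, mu0 (A n) + 1 ≤ c n) (hct : ∀ n, c n < ⊤) :
    ∃ E : ℕ → Set (ℝ × Fin 2), (∀ n, MeasurableSet (E n)) ∧
      Pairwise (Function.onFun Disjoint E) ∧
      (⋃ n, E n) = Set.Ioi (0:ℝ) ×ˢ (Set.univ : Set (Fin 2)) ∧ (∀ n, νSum (E n) = c n) ∧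
      (∀ n t, 0 < t → t ∈ A n → (t, (0 : Fin 2)) ∈ E n) ∧
      (∀ n t, (t, (0 : Fin 2)) ∈ E n → t ∈ (⋃ n, A n) → t ∈ A n) := by
  set W : ℕ → Set (ℝ × Fin 2) := fun n => (Set.Ioi 0 ∩ A n) ×ˢ {0} with hW
  have hWm : ∀ n, MeasurableSet (W n) := fun n =>
    (measurableSet_Ioi.inter (hA n)).prod (measurableSet_singleton _)
  have hWd : Pairwise (Function.onFun Disjoint W) := by
    intro m n hmn
    show Disjoint (W m) (W n)
    rw [Set.disjoint_left]
    intro p hp hp'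
    exact Set.disjoint_left.1 (hd hmn) hp.1.2 hp'.1.2
  have hWv : ∀ n, νSum (W n) = mu0 (A n) := by
    intro n
    rw [nu_apply (hWm n)]
    have e1 : {t : ℝ | (t, (0 : Fin 2)) ∈ W n} = A n ∩ Set.Ioi 0 := by
      ext t; simp [hW, and_comm]
    have e2 : {t : ℝ | (t, (1 : Fin 2)) ∈ W n} = ∅ := by
      ext t; simp [hW]
    rw [e1, e2, Measure.restrict_apply ((hA n).inter measurableSet_Ioi), Measure.restrict_apply (hA n),
      Set.inter_assoc, Set.inter_self]
    simp
  set Z : Set (ℝ × Fin 2) := (Set.Ioi (0:ℝ) ×ˢ (Set.univ : Set (Fin 2))) \ ⋃ n, W n with hZ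
  have hZm : MeasurableSet Z :=
    (measurableSet_Ioi.prod MeasurableSet.univ).diff (MeasurableSet.iUnion hWm)
  have hZt : νSum Z = ⊤ := by
    rw [nu_apply hZm]
    have : mu0 {t : ℝ | (t, (1 : Fin 2)) ∈ Z} = ⊤ := by
      have : {t : ℝ | (t, (1 : Fin 2)) ∈ Z} = Set.Ioi 0 := by
        ext t; simp [hZ, hW]
      rw [this]; simp
    rw [this]; simp
  have hAt : ∀ n, mu0 (A n) ≠ ⊤ := fun n =>
    (lt_of_le_of_lt (le_self_add.trans (hc n)) (hct n)).ne
  obtain ⟨P, p1, p2, p3, p4⟩ := lemPad Z hZm Set.sdiff_subset hZt (fun n => c n - mu0 (A n))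
    (fun n => ENNReal.le_sub_of_add_le_left (hAt n) (hc n))
    (fun n => lt_of_le_of_lt tsub_le_self (hct n))
  have hPZ : ∀ n, P n ⊆ Z := fun n => by rw [← p3]; exact Set.subset_iUnion P n
  have hWP : ∀ m n, Disjoint (W m) (P n) := by
    intro m n
    rw [Set.disjoint_left]
    intro p hp hp'
    exact (hPZ n hp').2 (Set.mem_iUnion.2 ⟨m, hp⟩)
  refine ⟨fun n => W n ∪ P n, fun n => (hWm n).union (p1 n), ?_, ?_, ?_, ?_, ?_⟩
  · intro m n hmn
    show Disjoint (W m ∪ P m) (W n ∪ P n)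
    rw [Set.disjoint_union_left, Set.disjoint_union_right, Set.disjoint_union_right]
    exact ⟨⟨hWd hmn, hWP _ _⟩, (hWP _ _).symm, p2 hmn⟩
  · rw [Set.iUnion_union_distrib, p3, hZ, Set.union_sdiff_cancel]
    apply Set.iUnion_subset
    intro n p hp
    exact ⟨hp.1.1, Set.mem_univ _⟩
  · intro n
    rw [measure_union (hWP n n) (p1 n), hWv, p4]
    exact add_tsub_cancel_of_le (le_self_add.trans (hc n))
  · intro n t ht htA
    exact Or.inl ⟨⟨ht, htA⟩, rfl⟩
  · rintro n t (h | h) htA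
    · exact h.1.2
    · exfalso
      have h1 := hPZ n h
      obtain ⟨m, hm⟩ := Set.mem_iUnion.1 htA
      exact h1.2 (Set.mem_iUnion.2 ⟨m, ⟨h1.1.1, hm⟩, rfl⟩)

lemma lft_ae {y y0 : ℝ → ℝ} (he : y0 =ᵐ[mu0] y) (A : ℕ → Set ℝ) (E : ℕ → Set (ℝ × Fin 2))
    (h1 : ∀ n t, 0 < t → t ∈ A n → (t, (0 : Fin 2)) ∈ E n)
    (h2 : ∀ n t, (t, (0 : Fin 2)) ∈ E n → t ∈ (⋃ n, A n) → t ∈ A n)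
    (h3 : ∀ᵐ p ∂mu0, p ∉ (⋃ n, A n) → y p = 0) (n : ℕ) :
    (E n).indicator (fun p : ℝ × Fin 2 => if p.2 = 0 then y0 p.1 else 0) =ᵐ[νSum]
      lft ((A n).indicator y) := by
  apply nu_ae
  · filter_upwards [he, h3, ae_restrict_mem measurableSet_Ioi] with t e1 e2 e3
    have r : lft ((A n).indicator y) (t, 0) = (A n).indicator y t := by simp [lft]
    rw [r]
    by_cases hE : (t, (0 : Fin 2)) ∈ E n
    · rw [Set.indicator_of_mem hE]
      simp only [if_true]
      rw [e1]
      by_cases hA : t ∈ A n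
      · rw [Set.indicator_of_mem hA]
      · rw [Set.indicator_of_notMem hA]
        exact e2 fun h => hA (h2 n t hE h)
    · rw [Set.indicator_of_notMem hE, Set.indicator_of_notMem fun h => hE (h1 n t e3 h)]
  · intro t
    simp [lft, Set.indicator]
lemma pos_ind (A : Set ℝ) (y : ℝ → ℝ) : posPart' (A.indicator y) = A.indicator (posPart' y) := by
  ext p; unfold posPart'; by_cases h : p ∈ A <;> simp [h]

lemma neg_ind (A : Set ℝ) (y : ℝ → ℝ) : negPart' (A.indicator y) = A.indicator (negPart' y) := by
  ext p; unfold negPart'; by_cases h : p ∈ A <;> simp [h]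


/-- Decomposition of a majorization `x ≺ y` on `(0,∞)` into countably many
majorizations on disjoint pieces of finite equal measure covering `(0,∞) ⊕ (0,∞)`. -/
theorem stmt10 (x y : ℝ → ℝ) (hx : IntegrableOn x (Set.Ioi 0))
    (hy : IntegrableOn y (Set.Ioi 0)) (hmaj : Maj x y) :
    ∃ A B : ℕ → Set (ℝ × Fin 2),
      (∀ n, MeasurableSet (A n)) ∧ (∀ n, MeasurableSet (B n)) ∧
      Pairwise (Function.onFun Disjoint A) ∧ Pairwise (Function.onFun Disjoint B) ∧
      (∀ n, νSum (A n) = νSum (B n) ∧ νSum (A n) < ⊤) ∧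
      (⋃ n, A n) = Set.Ioi (0:ℝ) ×ˢ (Set.univ : Set (Fin 2)) ∧
      (⋃ n, B n) = Set.Ioi (0:ℝ) ×ˢ (Set.univ : Set (Fin 2)) ∧
      (∀ n, MajM νSum
        ((B n).indicator (fun p : ℝ × Fin 2 => if p.2 = 0 then x p.1 else 0))
        ((A n).indicator (fun p : ℝ × Fin 2 => if p.2 = 0 then y p.1 else 0))) := by
  obtain ⟨h1, h2, h3⟩ := hmaj
  have hx' : Integrable x mu0 := hx
  have hy' : Integrable y mu0 := hy
  obtain ⟨X, hXm, hX⟩ : ∃ X : ℝ → ℝ, Measurable X ∧ x =ᵐ[mu0] X :=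
    ⟨_, hx'.aestronglyMeasurable.stronglyMeasurable_mk.measurable, hx'.aestronglyMeasurable.ae_eq_mk⟩
  obtain ⟨Y, hYm, hY⟩ : ∃ Y : ℝ → ℝ, Measurable Y ∧ y =ᵐ[mu0] Y :=
    ⟨_, hy'.aestronglyMeasurable.stronglyMeasurable_mk.measurable, hy'.aestronglyMeasurable.ae_eq_mk⟩
  have hXi : Integrable X mu0 := hx'.congr hX
  have hYi : Integrable Y mu0 := hy'.congr hY
  have cp : ∀ {u v : ℝ → ℝ}, u =ᵐ[mu0] v → posPart' u =ᵐ[mu0] posPart' v := by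
    intro u v h
    filter_upwards [h] with p hp
    unfold posPart'; rw [hp]
  have cn : ∀ {u v : ℝ → ℝ}, u =ᵐ[mu0] v → negPart' u =ᵐ[mu0] negPart' v := by
    intro u v h
    filter_upwards [h] with p hp
    unfold negPart'; rw [hp]
  have Hp : ∀ l, 0 ≤ l → FF mu0 (posPart' X) l ≤ FF mu0 (posPart' Y) l := by
    intro l hl
    rw [← FF_congr (cp hX), ← FF_congr (cp hY)]
    exact FF_of_sub hx'.pos_part (fun _ => le_max_right _ _) hy'.pos_part
      (fun _ => le_max_right _ _) h1 l hl
  have Hn : ∀ l, 0 ≤ l → FF mu0 (negPart' X) l ≤ FF mu0 (negPart' Y) l := by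
    intro l hl
    rw [← FF_congr (cn hX), ← FF_congr (cn hY)]
    exact FF_of_sub hx'.neg_part (fun _ => le_max_right _ _) hy'.neg_part
      (fun _ => le_max_right _ _) h2 l hl
  have hE : ∫ p, X p ∂mu0 = ∫ p, Y p ∂mu0 := by
    rw [← integral_congr_ae hX, ← integral_congr_ae hY]; exact h3
  obtain ⟨A, B, a1, a2, a3, a4, a5, a6, a7, a8, a9, a10, a11⟩ :=
    lemS X Y hXm hXi hYm hYi Hp Hn hE
  set c : ℕ → ENNReal := fun n => max (mu0 (A n)) (mu0 (B n)) + 1 with hc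
  have hct : ∀ n, c n < ⊤ := fun n =>
    ENNReal.add_lt_top.2 ⟨max_lt (a5 n) (a6 n), ENNReal.one_lt_top⟩
  obtain ⟨E, e1, e2, e3, e4, e5, e6⟩ := lemPad2 A a1 a3 c
    (fun n => add_le_add (le_max_left _ _) le_rfl) hct
  obtain ⟨F, f1, f2, f3, f4, f5, f6⟩ := lemPad2 B a2 a4 c
    (fun n => add_le_add (le_max_right _ _) le_rfl) hct
  refine ⟨E, F, e1, f1, e2, f2, fun n => ⟨by rw [e4, f4], by rw [e4]; exact hct n⟩, e3, f3, ?_⟩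
  intro n
  refine lemM (lft_ae hX B F f5 f6 a10 n) (lft_ae hY A E e5 e6 a11 n)
    (hXi.indicator (a2 n)) (hYi.indicator (a1 n)) ?_ ?_ ?_
  · intro l hl
    rw [pos_ind, pos_ind]; exact a7 n l hl
  · intro l hl
    rw [neg_ind, neg_ind]; exact a8 n l hl
  · rw [integral_indicator (a2 n), integral_indicator (a1 n)]; exact a9 n
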